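/- arXiv:1509.08545 — 2 statements merged into one kernel-verified Lean document; each statement's English description precedes it below -/
import Mathlib

section
/- Let d ≥ 1, and let u ∈ C¹([0,1], ℓ²(ℤ^d)) satisfy |i∂_t u_j(t) + Δ_d u_j(t)| ≤ |V_j(t) u_j(t)| for all t ∈ [0,1] and j ∈ ℤ^d, where V is a bounded potential (sup_{t∈[0,1], j∈ℤ^d} |V_j(t)| < ∞). Then there exists μ₀ = μ₀(d) > 0 such that if for some μ > μ₀ one has Σ_{j∈ℤ^d} e^{2μ|j| log(|j|+1)} (|u_j(0)|² + |u_j(1)|²) < +∞, then u ≡ 0 (i.e., u_j(t) = 0 for all j ∈ ℤ^d and t ∈ [0,1]). -/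
open MeasureTheory

/-- Euclidean norm of a lattice point of `ℤ^d`. -/
noncomputable def latNorm {d : ℕ} (j : Fin d → ℤ) : ℝ :=
  Real.sqrt (∑ k, ((j k : ℝ)) ^ 2)

/-- Discrete Laplacian on `ℤ^d`:
`Δ_d f j = Σ_{k=1}^d (f (j+e_k) + f (j-e_k) - 2 f j)`. -/
noncomputable def discreteLap {d : ℕ} (f : (Fin d → ℤ) → ℂ) (j : Fin d → ℤ) : ℂ :=
  ∑ k, (f (j + Pi.single k 1) + f (j - Pi.single k 1) - 2 * f j)

/-- The `ℓ¹` norm of a lattice point. -/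
noncomputable def latL1 {d : ℕ} (j : Fin d → ℤ) : ℝ := ∑ k, |(j k : ℝ)|

/-- Two-sided Grönwall estimate. -/
theorem le_exp_mul_of_abs_deriv_le {H H' : ℝ → ℝ} {a b c : ℝ} (hc : 0 ≤ c)
    (hab : b - a ≤ 1) (hcont : ContinuousOn H (Set.Icc a b))
    (hderiv : ∀ t ∈ Set.Ioo a b, HasDerivAt H (H' t) t)
    (hbound : ∀ t ∈ Set.Ioo a b, |H' t| ≤ c * H t) (h0 : ∀ t ∈ Set.Icc a b, 0 ≤ H t)
    {s t : ℝ} (hs : s ∈ Set.Icc a b) (ht : t ∈ Set.Icc a b) : H t ≤ Real.exp c * H s := by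
  rcases le_total s t with hst | hst
  · have hanti : AntitoneOn (fun x => Real.exp (-c * x) * H x) (Set.Icc a b) := by
      have hd : ∀ x ∈ Set.Ioo a b, HasDerivAt (fun x => Real.exp (-c * x) * H x)
          (Real.exp (-c * x) * (-c * 1) * H x + Real.exp (-c * x) * H' x) x := fun x hx =>
        (((hasDerivAt_id x).const_mul (-c)).exp).mul (hderiv x hx)
      refine antitoneOn_of_deriv_nonpos (convex_Icc a b) (by fun_prop) ?_ ?_
      · rw [interior_Icc]
        exact fun x hx => (hd x hx).differentiableAt.differentiableWithinAt
      · rw [interior_Icc]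
        intro x hx
        rw [(hd x hx).deriv]
        have := (abs_le.mp (hbound x hx)).2
        nlinarith [Real.exp_pos (-c * x)]
    have h1 := hanti hs ht hst
    simp only at h1
    have h2 : Real.exp (-c * s) = Real.exp (-c * t) * Real.exp (c * (t - s)) := by
      rw [← Real.exp_add]; ring_nf
    rw [h2, mul_assoc] at h1
    have h3 := le_of_mul_le_mul_left h1 (Real.exp_pos _)
    refine h3.trans (mul_le_mul_of_nonneg_right (Real.exp_le_exp.mpr ?_) (h0 s hs))
    have := hs.1; have := ht.2
    nlinarith
  · have hmono : MonotoneOn (fun x => Real.exp (c * x) * H x) (Set.Icc a b) := by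
      have hd : ∀ x ∈ Set.Ioo a b, HasDerivAt (fun x => Real.exp (c * x) * H x)
          (Real.exp (c * x) * (c * 1) * H x + Real.exp (c * x) * H' x) x := fun x hx =>
        (((hasDerivAt_id x).const_mul c).exp).mul (hderiv x hx)
      refine monotoneOn_of_deriv_nonneg (convex_Icc a b) (by fun_prop) ?_ ?_
      · rw [interior_Icc]
        exact fun x hx => (hd x hx).differentiableAt.differentiableWithinAt
      · rw [interior_Icc]
        intro x hx
        rw [(hd x hx).deriv]
        have := (abs_le.mp (hbound x hx)).1
        nlinarith [Real.exp_pos (c * x)]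
    have h1 := hmono ht hs hst
    simp only at h1
    have h2 : Real.exp (c * s) = Real.exp (c * t) * Real.exp (c * (s - t)) := by
      rw [← Real.exp_add]; ring_nf
    rw [h2, mul_assoc] at h1
    have h3 := le_of_mul_le_mul_left h1 (Real.exp_pos _)
    refine h3.trans (mul_le_mul_of_nonneg_right (Real.exp_le_exp.mpr ?_) (h0 s hs))
    have := ht.1; have := hs.2
    nlinarith

theorem weighted_cross_term_le {Λ v w : ℝ} (hΛ : 0 < Λ) (hv : 0 ≤ v)
    (h : v ≤ Λ ^ 2 * w) (x y : ℝ) : v * (2 * x * y) ≤ Λ * (v * x ^ 2 + w * y ^ 2) := by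
  have e1 : Λ * (v * x ^ 2 + w * y ^ 2) - v * (2 * x * y) =
      v / Λ * (Λ * x - y) ^ 2 + (Λ ^ 2 * w - v) / Λ * y ^ 2 := by
    field_simp; ring
  have e2 : 0 ≤ v / Λ * (Λ * x - y) ^ 2 :=
    mul_nonneg (div_nonneg hv hΛ.le) (sq_nonneg _)
  have e3 : 0 ≤ (Λ ^ 2 * w - v) / Λ * y ^ 2 :=
    mul_nonneg (div_nonneg (by linarith) hΛ.le) (sq_nonneg _)
  linarith

section Lattice

variable {d : ℕ}

theorem latL1_nonneg (j : Fin d → ℤ) : 0 ≤ latL1 j :=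
  Finset.sum_nonneg fun _ _ => abs_nonneg _

theorem abs_coord_le_latL1 (j : Fin d → ℤ) (k : Fin d) : |(j k : ℝ)| ≤ latL1 j :=
  Finset.single_le_sum (f := fun k => |(j k : ℝ)|) (fun _ _ => abs_nonneg _) (Finset.mem_univ k)

theorem abs_coord_le_latNorm (j : Fin d → ℤ) (k : Fin d) : |(j k : ℝ)| ≤ latNorm j := by
  apply Real.abs_le_sqrt
  exact Finset.single_le_sum (f := fun k => (j k : ℝ) ^ 2) (fun _ _ => sq_nonneg _)
    (Finset.mem_univ k)

theorem latNorm_nonneg (j : Fin d → ℤ) : 0 ≤ latNorm j := Real.sqrt_nonneg _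

theorem latL1_le_mul_latNorm (j : Fin d → ℤ) : latL1 j ≤ d * latNorm j := by
  have := Finset.sum_le_card_nsmul Finset.univ (fun k => |(j k : ℝ)|) (latNorm j)
    (fun k _ => abs_coord_le_latNorm j k)
  simpa [latL1] using this

theorem latL1_add_le (i j : Fin d → ℤ) : latL1 (i + j) ≤ latL1 i + latL1 j := by
  unfold latL1
  rw [← Finset.sum_add_distrib]
  refine Finset.sum_le_sum fun k _ => ?_
  push_cast [Pi.add_apply]
  exact abs_add_le _ _

theorem latL1_neg (j : Fin d → ℤ) : latL1 (-j) = latL1 j := by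
  simp [latL1]

theorem latL1_sub_le (i j : Fin d → ℤ) : latL1 (i - j) ≤ latL1 i + latL1 j := by
  simpa [sub_eq_add_neg, latL1_neg] using latL1_add_le i (-j)

theorem latL1_single (k : Fin d) : latL1 (Pi.single k (1 : ℤ) : Fin d → ℤ) = 1 := by
  unfold latL1
  rw [Finset.sum_eq_single k] <;> simp +contextual

theorem summable_exp_neg_abs_int {c : ℝ} (hc : 0 < c) :
    Summable fun n : ℤ => Real.exp (-c * |(n : ℝ)|) := by
  have h : Summable fun n : ℕ => Real.exp (-c * n) := by
    have := Real.summable_exp_nat_mul_iff.mpr (neg_lt_zero.mpr hc)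
    refine this.congr fun n => ?_
    ring_nf
  rw [summable_int_iff_summable_nat_and_neg]
  constructor <;> simpa using h

theorem summable_exp_neg_latL1 {c : ℝ} (hc : 0 < c) :
    ∀ d : ℕ, Summable fun j : Fin d → ℤ => Real.exp (-c * latL1 j)
  | 0 => Summable.of_finite
  | d + 1 => by
    rw [← (Fin.consEquiv fun _ => ℤ).summable_iff]
    refine ((summable_exp_neg_abs_int hc).mul_of_nonneg (summable_exp_neg_latL1 hc d)
      (fun _ => (Real.exp_pos _).le) (fun _ => (Real.exp_pos _).le)).congr fun x => ?_
    simp only [Function.comp, Fin.consEquiv, Equiv.coe_fn_mk, latL1, Fin.sum_univ_succ,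
      Fin.cons_zero, Fin.cons_succ]
    rw [← Real.exp_add, mul_add]

/-- A componentwise `C¹` evolution on `[0,1]` which solves the free discrete Schrödinger equation
up to an error bounded by `L |u|`. -/
structure IsPerturbedSolution (u u' : ℝ → (Fin d → ℤ) → ℂ) (L : ℝ) : Prop where
  nonneg : 0 ≤ L
  deriv : ∀ j, ∀ t ∈ Set.Icc (0 : ℝ) 1,
    HasDerivWithinAt (fun s => u s j) (u' t j) (Set.Icc (0 : ℝ) 1) t
  bound : ∀ t ∈ Set.Icc (0 : ℝ) 1, ∀ j,
    ‖u' t j - Complex.I * discreteLap (u t) j‖ ≤ L * ‖u t j‖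

theorem norm_discreteLap_le (f : (Fin d → ℤ) → ℂ) (j : Fin d → ℤ) :
    ‖discreteLap f j‖ ≤
      (∑ k, (‖f (j + Pi.single k 1)‖ + ‖f (j - Pi.single k 1)‖)) + 2 * d * ‖f j‖ := by
  have h : (2 * d * ‖f j‖ : ℝ) = ∑ _k : Fin d, 2 * ‖f j‖ := by simp; ring
  rw [h, ← Finset.sum_add_distrib]
  refine (norm_sum_le _ _).trans (Finset.sum_le_sum fun k _ => ?_)
  refine (norm_sub_le _ _).trans (add_le_add (norm_add_le _ _) ?_)
  simp

theorem _root_.HasSum.comp_add_right {G : Type*} [AddCommGroup G] {F : G → ℝ} {S : ℝ}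
    (hF : HasSum F S) (v : G) : HasSum (fun j => F (j + v)) S := by
  have h := (Equiv.addRight v).hasSum_iff.mpr hF
  exact h

theorem _root_.HasSum.comp_sub_right {G : Type*} [AddCommGroup G] {F : G → ℝ} {S : ℝ}
    (hF : HasSum F S) (v : G) : HasSum (fun j => F (j - v)) S := by
  have h := (Equiv.subRight v).hasSum_iff.mpr hF
  exact h

theorem hasSum_neighbours {W : (Fin d → ℤ) → ℝ} {S : ℝ} (hW : HasSum W S) (Λ c : ℝ) :
    HasSum (fun j => (∑ k : Fin d, (Λ * (W j + W (j + Pi.single k 1))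
      + Λ * (W j + W (j - Pi.single k 1)))) + c * W j) ((4 * d * Λ + c) * S) := by
  have hp : ∀ k : Fin d, HasSum (fun j => W (j + Pi.single k 1)) S := fun k =>
    hW.comp_add_right (Pi.single k 1)
  have hm : ∀ k : Fin d, HasSum (fun j => W (j - Pi.single k 1)) S := fun k =>
    hW.comp_sub_right (Pi.single k 1)
  have hk : ∀ k ∈ (Finset.univ : Finset (Fin d)), HasSum (fun j =>
      Λ * (W j + W (j + Pi.single k 1)) + Λ * (W j + W (j - Pi.single k 1)))
      (Λ * (S + S) + Λ * (S + S)) := fun k _ =>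
    ((hW.add (hp k)).mul_left Λ).add ((hW.add (hm k)).mul_left Λ)
  have h := (hasSum_sum hk).add (hW.mul_left c)
  convert h using 1
  simp only [Finset.sum_const, Finset.card_univ, Fintype.card_fin, nsmul_eq_mul]
  ring

namespace IsPerturbedSolution

variable {u u' : ℝ → (Fin d → ℤ) → ℂ} {L : ℝ}

theorem norm_deriv_le (h : IsPerturbedSolution u u' L) {t : ℝ} (ht : t ∈ Set.Icc (0 : ℝ) 1)
    (j : Fin d → ℤ) :
    ‖u' t j‖ ≤ (∑ k, (‖u t (j + Pi.single k 1)‖ + ‖u t (j - Pi.single k 1)‖))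
      + (2 * d + L) * ‖u t j‖ := by
  have h1 := norm_le_norm_sub_add (u' t j) (Complex.I * discreteLap (u t) j)
  have h2 := h.bound t ht j
  have h3 := norm_discreteLap_le (u t) j
  rw [norm_mul, Complex.norm_I, one_mul] at h1
  linarith

theorem hasDerivAt (h : IsPerturbedSolution u u' L) {t : ℝ} (ht : t ∈ Set.Ioo (0 : ℝ) 1)
    (j : Fin d → ℤ) : HasDerivAt (fun s => u s j) (u' t j) t :=
  (h.deriv j t (Set.Ioo_subset_Icc_self ht)).hasDerivAt (Icc_mem_nhds ht.1 ht.2)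

theorem continuousOn (h : IsPerturbedSolution u u' L) (j : Fin d → ℤ) :
    ContinuousOn (fun s => u s j) (Set.Icc (0 : ℝ) 1) :=
  fun t ht => (h.deriv j t ht).continuousWithinAt

/-- Energy estimate with a summable weight `w` which changes by at most a factor `Λ²` between
neighbours. -/
theorem weighted_energy_le (h : IsPerturbedSolution u u' L) {a b M Λ : ℝ} (ha : 0 ≤ a)
    (hb : b ≤ 1) (hM : ∀ t ∈ Set.Icc a b, ∀ j, ‖u t j‖ ≤ M)
    {w : (Fin d → ℤ) → ℝ} (hw : ∀ j, 0 ≤ w j) (hws : Summable w) (hΛ : 0 < Λ)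
    (hplus : ∀ j k, w j ≤ Λ ^ 2 * w (j + Pi.single k 1))
    (hminus : ∀ j k, w j ≤ Λ ^ 2 * w (j - Pi.single k 1))
    {s t : ℝ} (hs : s ∈ Set.Icc a b) (ht : t ∈ Set.Icc a b) :
    (∑' j, w j * ‖u t j‖ ^ 2) ≤
      Real.exp (4 * d * Λ + 4 * d + 2 * L) * ∑' j, w j * ‖u s j‖ ^ 2 := by
  have hL := h.nonneg
  have hM0 : 0 ≤ M := (norm_nonneg _).trans (hM s hs 0)
  have hIcc : Set.Icc a b ⊆ Set.Icc (0 : ℝ) 1 := Set.Icc_subset_Icc ha hb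
  have hIoo : Set.Ioo a b ⊆ Set.Ioo (0 : ℝ) 1 := Set.Ioo_subset_Ioo ha hb
  have hterm : ∀ t ∈ Set.Icc a b, ∀ j, ‖w j * ‖u t j‖ ^ 2‖ ≤ w j * M ^ 2 := by
    intro t ht j
    rw [Real.norm_of_nonneg (mul_nonneg (hw j) (sq_nonneg _))]
    have := hM t ht j
    gcongr
    exact hw j
  have hsum : ∀ t ∈ Set.Icc a b, Summable fun j => w j * ‖u t j‖ ^ 2 := fun t ht =>
    Summable.of_norm_bounded (hws.mul_right (M ^ 2)) (hterm t ht)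
  have hM' : ∀ t ∈ Set.Icc a b, ∀ j, ‖u' t j‖ ≤ (4 * d + L) * M := by
    intro t ht j
    refine (h.norm_deriv_le (hIcc ht) j).trans ?_
    have h1 : (∑ k, (‖u t (j + Pi.single k 1)‖ + ‖u t (j - Pi.single k 1)‖)) ≤
        ∑ _k : Fin d, 2 * M :=
      Finset.sum_le_sum fun k _ => by
        linarith [hM t ht (j + Pi.single k 1), hM t ht (j - Pi.single k 1)]
    have h2 : (2 * d + L) * ‖u t j‖ ≤ (2 * d + L) * M :=
      mul_le_mul_of_nonneg_left (hM t ht j) (by positivity)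
    simp at h1
    linarith
  have hinner : ∀ t j, |2 * inner ℝ (u t j) (u' t j)| ≤ 2 * (‖u t j‖ * ‖u' t j‖) := by
    intro t j
    rw [abs_mul, abs_two]
    exact mul_le_mul_of_nonneg_left (abs_real_inner_le_norm _ _) zero_le_two
  have hdbound : ∀ t ∈ Set.Icc a b, ∀ j,
      ‖w j * (2 * inner ℝ (u t j) (u' t j))‖ ≤ w j * (2 * (M * ((4 * d + L) * M))) := by
    intro t ht j
    rw [norm_mul, Real.norm_of_nonneg (hw j)]
    refine mul_le_mul_of_nonneg_left ((hinner t j).trans ?_) (hw j)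
    have := hM t ht j
    have := hM' t ht j
    gcongr
  refine le_exp_mul_of_abs_deriv_le (a := a) (b := b) (H := fun t => ∑' j, w j * ‖u t j‖ ^ 2)
    (H' := fun t => ∑' j, w j * (2 * inner ℝ (u t j) (u' t j)))
    (by positivity) (by linarith) ?_ ?_ ?_
    (fun t _ => tsum_nonneg fun j => mul_nonneg (hw j) (sq_nonneg _)) hs ht
  · exact continuousOn_tsum (fun j => continuousOn_const.mul
      (((h.continuousOn j).mono hIcc).norm.pow 2)) (hws.mul_right (M ^ 2))
      (fun j t ht => hterm t ht j)
  · intro t ht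
    exact hasDerivAt_tsum_of_isPreconnected (t := Set.Ioo a b)
      (hws.mul_right (2 * (M * ((4 * d + L) * M)))) isOpen_Ioo isPreconnected_Ioo
      (fun j y hy => ((h.hasDerivAt (hIoo hy) j).norm_sq).const_mul (w j))
      (fun j y hy => hdbound y (Set.Ioo_subset_Icc_self hy) j) ht
      (hsum t (Set.Ioo_subset_Icc_self ht)) ht
  · intro t ht
    have ht' := Set.Ioo_subset_Icc_self ht
    obtain ⟨W, hW⟩ : ∃ W : (Fin d → ℤ) → ℝ, W = fun j => w j * ‖u t j‖ ^ 2 := ⟨_, rfl⟩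
    have hWs : Summable W := hW ▸ hsum t ht'
    have hpt : ∀ j, ‖w j * (2 * inner ℝ (u t j) (u' t j))‖ ≤
        (∑ k : Fin d, (Λ * (W j + W (j + Pi.single k 1)) + Λ * (W j + W (j - Pi.single k 1))))
          + (4 * d + 2 * L) * W j := by
      intro j
      rw [norm_mul, Real.norm_of_nonneg (hw j)]
      have h1 := h.norm_deriv_le (hIcc ht') j
      have h2 : w j * |2 * inner ℝ (u t j) (u' t j)| ≤ w j * (2 * (‖u t j‖ *
          ((∑ k, (‖u t (j + Pi.single k 1)‖ + ‖u t (j - Pi.single k 1)‖))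
            + (2 * d + L) * ‖u t j‖))) := by
        refine mul_le_mul_of_nonneg_left ((hinner t j).trans ?_) (hw j)
        gcongr
      refine h2.trans ?_
      have h3 : w j * (2 * (‖u t j‖ *
          ((∑ k, (‖u t (j + Pi.single k 1)‖ + ‖u t (j - Pi.single k 1)‖))
            + (2 * d + L) * ‖u t j‖))) =
          (∑ k, (w j * (2 * ‖u t j‖ * ‖u t (j + Pi.single k 1)‖)
            + w j * (2 * ‖u t j‖ * ‖u t (j - Pi.single k 1)‖))) + (4 * d + 2 * L) * W j := by
        rw [hW, mul_add, mul_add, mul_add, Finset.mul_sum, Finset.mul_sum, Finset.mul_sum]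
        congr 1
        · exact Finset.sum_congr rfl fun k _ => by ring
        · ring
      rw [h3]
      have h4 : ∀ i, w j ≤ Λ ^ 2 * w i →
          w j * (2 * ‖u t j‖ * ‖u t i‖) ≤ Λ * (W j + W i) := fun i hi => by
        rw [hW]
        exact weighted_cross_term_le hΛ (hw j) hi _ _
      refine add_le_add_left (Finset.sum_le_sum fun k _ => add_le_add ?_ ?_) _
      · exact h4 _ (hplus j k)
      · exact h4 _ (hminus j k)
    have hR := hasSum_neighbours hWs.hasSum Λ (4 * d + 2 * L)
    have hLs := Summable.of_norm_bounded hR.summable hpt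
    refine (norm_tsum_le_tsum_norm hLs.norm).trans
      ((Summable.tsum_le_tsum hpt hLs.norm hR.summable).trans (le_of_eq ?_))
    rw [hR.tsum_eq, hW]
    ring

end IsPerturbedSolution

end Lattice

namespace IsPerturbedSolution

variable {d : ℕ} {u u' : ℝ → (Fin d → ℤ) → ℂ} {L : ℝ}

theorem norm_le_sqrt_tsum {f : (Fin d → ℤ) → ℂ} (hf : Summable fun j => ‖f j‖ ^ 2)
    (j : Fin d → ℤ) : ‖f j‖ ≤ √(∑' j, ‖f j‖ ^ 2) :=
  Real.le_sqrt_of_sq_le (hf.le_tsum j fun _ _ => sq_nonneg _)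

theorem latL1_add_single_le (j : Fin d → ℤ) (k : Fin d) :
    latL1 (j + Pi.single k 1) ≤ latL1 j + 1 := by
  simpa [latL1_single] using latL1_add_le j (Pi.single k 1)

theorem latL1_sub_single_le (j : Fin d → ℤ) (k : Fin d) :
    latL1 (j - Pi.single k 1) ≤ latL1 j + 1 := by
  simpa [latL1_single] using latL1_sub_le j (Pi.single k 1)

theorem le_latL1_add_single (j : Fin d → ℤ) (k : Fin d) :
    latL1 j ≤ latL1 (j + Pi.single k 1) + 1 := by
  have h := latL1_sub_single_le (j + Pi.single k 1) k
  rwa [add_sub_cancel_right] at h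

theorem le_latL1_sub_single (j : Fin d → ℤ) (k : Fin d) :
    latL1 j ≤ latL1 (j - Pi.single k 1) + 1 := by
  have h := latL1_add_single_le (j - Pi.single k 1) k
  rwa [sub_add_cancel] at h

theorem tsum_sq_le_of_bounded (h : IsPerturbedSolution u u' L)
    (hu : ∀ t ∈ Set.Icc (0 : ℝ) 1, Summable fun j => ‖u t j‖ ^ 2) {s t M : ℝ}
    (hs : s ∈ Set.Icc (0 : ℝ) 1) (ht : t ∈ Set.Icc (0 : ℝ) 1)
    (hM : ∀ x ∈ Set.uIcc s t, ∑' j, ‖u x j‖ ^ 2 ≤ M) :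
    ∑' j, ‖u t j‖ ^ 2 ≤
      Real.exp (4 * d * Real.exp 1 + 4 * d + 2 * L) * ∑' j, ‖u s j‖ ^ 2 := by
  refine (hu t ht).tsum_le_of_sum_le fun F => ?_
  obtain ⟨n, hn0, hn⟩ : ∃ n : ℝ, 0 ≤ n ∧ ∀ j ∈ F, latL1 j ≤ n :=
    ⟨∑ j ∈ F, latL1 j, Finset.sum_nonneg fun j _ => latL1_nonneg j, fun j hj =>
      Finset.single_le_sum (f := latL1) (fun j _ => latL1_nonneg j) hj⟩
  set w : (Fin d → ℤ) → ℝ := fun j => Real.exp (-2 * max (latL1 j - n) 0) with hw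
  have hw0 : ∀ j, 0 ≤ w j := fun j => (Real.exp_pos _).le
  have hw1 : ∀ j, w j ≤ 1 := fun j => by
    rw [hw, Real.exp_le_one_iff]
    linarith [le_max_right (latL1 j - n) 0]
  have hsub : Set.uIcc s t ⊆ Set.Icc 0 1 := Set.uIcc_subset_Icc hs ht
  have hcomp : ∀ i j, latL1 i ≤ latL1 j + 1 → w j ≤ Real.exp 1 ^ 2 * w i := by
    intro i j hij
    rw [hw, ← Real.exp_nat_mul, ← Real.exp_add, Real.exp_le_exp]
    have h1 := le_max_left (latL1 j - n) 0
    have h2 := le_max_right (latL1 j - n) 0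
    have h3 : max (latL1 i - n) 0 ≤ max (latL1 j - n) 0 + 1 := max_le (by linarith) (by linarith)
    push_cast
    linarith
  have hws : Summable w := by
    refine Summable.of_nonneg_of_le hw0 (fun j => ?_)
      ((summable_exp_neg_latL1 zero_lt_two d).mul_left (Real.exp (2 * n)))
    rw [← Real.exp_add, hw, Real.exp_le_exp]
    linarith [le_max_left (latL1 j - n) 0]
  have hbd : ∀ x ∈ Set.uIcc s t, ∀ j, ‖u x j‖ ≤ √M := fun x hx j =>
    (norm_le_sqrt_tsum (hu x (hsub hx)) j).trans (Real.sqrt_le_sqrt (hM x hx))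
  have hE := h.weighted_energy_le (a := min s t) (b := max s t) (le_min hs.1 ht.1)
    (max_le hs.2 ht.2) hbd hw0 hws (Real.exp_pos 1)
    (fun j k => hcomp _ _ (latL1_add_single_le j k))
    (fun j k => hcomp _ _ (latL1_sub_single_le j k))
    (Set.left_mem_uIcc : s ∈ Set.uIcc s t) (Set.right_mem_uIcc : t ∈ Set.uIcc s t)
  have hle : ∀ x, ∀ j, w j * ‖u x j‖ ^ 2 ≤ ‖u x j‖ ^ 2 := fun x j =>
    mul_le_of_le_one_left (sq_nonneg _) (hw1 j)
  have hsw : ∀ x ∈ Set.Icc (0 : ℝ) 1, Summable fun j => w j * ‖u x j‖ ^ 2 := fun x hx =>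
    Summable.of_nonneg_of_le (fun j => mul_nonneg (hw0 j) (sq_nonneg _)) (hle x) (hu x hx)
  calc ∑ j ∈ F, ‖u t j‖ ^ 2 = ∑ j ∈ F, w j * ‖u t j‖ ^ 2 := by
        refine Finset.sum_congr rfl fun j hj => ?_
        have : w j = 1 := by
          rw [hw]; simp [hn j hj]
        rw [this, one_mul]
    _ ≤ ∑' j, w j * ‖u t j‖ ^ 2 :=
        (hsw t ht).sum_le_tsum F fun j _ => mul_nonneg (hw0 j) (sq_nonneg _)
    _ ≤ _ := hE
    _ ≤ _ := mul_le_mul_of_nonneg_left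
        (Summable.tsum_le_tsum (hle s) (hsw s hs) (hu s hs)) (Real.exp_pos _).le

/-- The `ℓ²` norm of the evolution is automatically bounded on `[0,1]`, by a Baire category
argument. -/
theorem exists_tsum_sq_le (h : IsPerturbedSolution u u' L)
    (hu : ∀ t ∈ Set.Icc (0 : ℝ) 1, Summable fun j => ‖u t j‖ ^ 2) :
    ∃ M, ∀ t ∈ Set.Icc (0 : ℝ) 1, ∑' j, ‖u t j‖ ^ 2 ≤ M := by
  set N : ℝ → ℝ := fun t => ∑' j, ‖u t j‖ ^ 2 with hN
  set c : ℝ := Real.exp (4 * d * Real.exp 1 + 4 * d + 2 * L)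
  set good : Set ℝ := {t | ∃ U : Set ℝ, IsOpen U ∧ t ∈ U ∧
    ∃ M, ∀ x ∈ U ∩ Set.Icc 0 1, N x ≤ M} with hgood
  have hopen : IsOpen good := by
    rw [isOpen_iff_forall_mem_open]
    rintro t ⟨U, hU, htU, M, hM⟩
    exact ⟨U, fun x hx => ⟨U, hU, hx, M, hM⟩, hU, htU⟩
  have hcpt : ∀ K : Set ℝ, IsCompact K → K ⊆ Set.Icc 0 1 → K ⊆ good →
      ∃ M, ∀ x ∈ K, N x ≤ M := by
    intro K hK hK1 hKg
    refine hK.induction_on (p := fun s => ∃ M, ∀ x ∈ s, N x ≤ M) ⟨0, by simp⟩ ?_ ?_ ?_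
    · rintro s t hst ⟨M, hM⟩
      exact ⟨M, fun x hx => hM x (hst hx)⟩
    · rintro s t ⟨M, hM⟩ ⟨M', hM'⟩
      exact ⟨max M M', fun x hx => hx.elim (fun h => (hM x h).trans (le_max_left _ _))
        fun h => (hM' x h).trans (le_max_right _ _)⟩
    · intro x hx
      obtain ⟨U, hU, hxU, M, hM⟩ := hKg hx
      refine ⟨U ∩ K, Filter.inter_mem (mem_nhdsWithin_of_mem_nhds (hU.mem_nhds hxU))
        self_mem_nhdsWithin, M, fun y hy => hM y ⟨hy.1, hK1 hy.2⟩⟩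
  set bad : Set ℝ := Set.Icc 0 1 \ good with hbad
  have hbadc : IsClosed bad := isClosed_Icc.sdiff hopen
  rcases bad.eq_empty_or_nonempty with hemp | hne
  · exact hcpt _ isCompact_Icc subset_rfl (Set.sdiff_eq_empty.mp hemp)
  exfalso
  have : Nonempty bad := hne.to_subtype
  have : CompleteSpace bad := hbadc.completeSpace_coe
  obtain ⟨n, ⟨x₀, hx₀⟩⟩ := nonempty_interior_of_iUnion_of_closed
    (X := bad) (f := fun n : ℕ => {x : bad | N x ≤ n}) (by
      intro n
      have : {x : bad | N x ≤ n} = ⋂ F : Finset (Fin d → ℤ),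
          {x : bad | ∑ j ∈ F, ‖u x j‖ ^ 2 ≤ n} := by
        ext x
        simp only [Set.mem_ofPred_eq, Set.mem_iInter]
        refine ⟨fun hx F => ((hu x x.2.1).sum_le_tsum F fun _ _ => sq_nonneg _).trans hx,
          fun hx => (hu x x.2.1).tsum_le_of_sum_le hx⟩
      rw [this]
      refine isClosed_iInter fun F => isClosed_le ?_ continuous_const
      refine continuous_finsetSum _ fun j _ => ?_
      have hc : Continuous fun x : bad => u x j :=
        (h.continuousOn j).comp_continuous continuous_subtype_val fun x => x.2.1
      exact hc.norm.pow 2)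
    (by
      refine Set.eq_univ_of_forall fun x => Set.mem_iUnion.mpr ?_
      exact exists_nat_ge (N x))
  rw [mem_interior_iff_mem_nhds, mem_nhds_subtype] at hx₀
  obtain ⟨W, hW, hWs⟩ := hx₀
  obtain ⟨r, hr, hrW⟩ := Metric.mem_nhds_iff.mp hW
  have hball : ∀ x ∈ bad, |x - x₀| < r → N x ≤ n := fun x hx hxr =>
    hWs (a := ⟨x, hx⟩) (hrW (by rwa [Metric.mem_ball, Real.dist_eq]))
  refine x₀.2.2 ⟨Metric.ball x₀ r, Metric.isOpen_ball, Metric.mem_ball_self hr, c * n, ?_⟩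
  rintro t ⟨htr, ht⟩
  rw [Metric.mem_ball, Real.dist_eq] at htr
  have hx₀I : (x₀ : ℝ) ∈ Set.Icc (0 : ℝ) 1 := x₀.2.1
  obtain ⟨a, ⟨haB, hau⟩, hmin⟩ := (isCompact_uIcc.inter_left hbadc :
      IsCompact (bad ∩ Set.uIcc (x₀ : ℝ) t)).exists_isMinOn
    ⟨x₀, x₀.2, Set.left_mem_uIcc⟩ (f := fun x => |x - t|) (by fun_prop)
  have haI : a ∈ Set.Icc (0 : ℝ) 1 := haB.1
  have hgt : ∀ x ∈ Set.uIcc a t, x ≠ a → x ∈ good := by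
    intro x hx hxa
    by_contra hxg
    have hxI := Set.uIcc_subset_Icc haI ht hx
    have hxu := Set.uIcc_subset_uIcc hau (Set.right_mem_uIcc) hx
    have h1 : |a - t| ≤ |x - t| := hmin ⟨⟨hxI, hxg⟩, hxu⟩
    apply hxa
    rcases Set.mem_uIcc.mp hx with ⟨h2, h3⟩ | ⟨h2, h3⟩
    · rw [abs_of_nonpos (by linarith), abs_of_nonpos (by linarith)] at h1
      linarith
    · rw [abs_of_nonneg (by linarith), abs_of_nonneg (by linarith)] at h1
      linarith
  have hNa : N a ≤ n := by
    refine hball a haB (lt_of_le_of_lt ?_ htr)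
    have := Set.abs_sub_left_of_mem_uIcc hau
    linarith
  have hbdd : ∀ x ∈ Set.uIcc a t, N x ≤ max (c * N t) n := by
    intro x hx
    by_cases hxa : x = a
    · rw [hxa]; exact hNa.trans (le_max_right _ _)
    · have hsub : Set.uIcc t x ⊆ Set.uIcc a t :=
        Set.uIcc_subset_uIcc Set.right_mem_uIcc hx
      have hxI := Set.uIcc_subset_Icc haI ht hx
      have hana : a ∉ Set.uIcc t x := by
        intro haux
        apply hxa
        rcases Set.mem_uIcc.mp hx with ⟨h2, h3⟩ | ⟨h2, h3⟩ <;>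
        rcases Set.mem_uIcc.mp haux with ⟨h4, h5⟩ | ⟨h4, h5⟩ <;> linarith
      obtain ⟨M, hM⟩ := hcpt (Set.uIcc t x) isCompact_uIcc
        (Set.uIcc_subset_Icc ht hxI)
        fun y hy => hgt y (hsub hy) fun hya => hana (hya ▸ hy)
      exact (h.tsum_sq_le_of_bounded hu ht hxI hM).trans (le_max_left _ _)
  refine (h.tsum_sq_le_of_bounded hu haI ht hbdd).trans ?_
  exact mul_le_mul_of_nonneg_left hNa (Real.exp_pos _).le

theorem eq_zero_of_eq_zero (h : IsPerturbedSolution u u' L)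
    (hu : ∀ t ∈ Set.Icc (0 : ℝ) 1, Summable fun j => ‖u t j‖ ^ 2) {s t : ℝ}
    (hs : s ∈ Set.Icc (0 : ℝ) 1) (ht : t ∈ Set.Icc (0 : ℝ) 1) (h0 : ∀ j, u s j = 0)
    (j : Fin d → ℤ) : u t j = 0 := by
  obtain ⟨M, hM⟩ := h.exists_tsum_sq_le hu
  have h1 := h.tsum_sq_le_of_bounded hu hs ht fun x hx => hM x (Set.uIcc_subset_Icc hs ht hx)
  have h2 := (hu t ht).le_tsum j fun _ _ => sq_nonneg _
  simp only [h0, norm_zero, ne_eq, OfNat.ofNat_ne_zero, not_false_eq_true, zero_pow, tsum_zero,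
    mul_zero] at h1
  have : ‖u t j‖ ^ 2 = 0 := le_antisymm (h2.trans h1) (sq_nonneg _)
  simpa using this

/-- Superexponential decay at time `0` propagates to all times. -/
theorem exists_decay (h : IsPerturbedSolution u u' L)
    (hu : ∀ t ∈ Set.Icc (0 : ℝ) 1, Summable fun j => ‖u t j‖ ^ 2) {μ : ℝ} (hμ : 2 * d ≤ μ)
    (h0 : Summable fun j : Fin d → ℤ =>
      Real.exp (2 * μ * latNorm j * Real.log (latNorm j + 1)) * ‖u 0 j‖ ^ 2) :
    ∃ C B : ℝ, 0 ≤ B ∧ ∀ t ∈ Set.Icc (0 : ℝ) 1, ∀ j,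
      ‖u t j‖ ≤ C * Real.exp (B * latL1 j - latL1 j * Real.log (1 + latL1 j)) := by
  obtain ⟨M, hM⟩ := h.exists_tsum_sq_le hu
  have hL := h.nonneg
  set S := ∑' j : Fin d → ℤ,
      Real.exp (2 * μ * latNorm j * Real.log (latNorm j + 1)) * ‖u 0 j‖ ^ 2
  obtain ⟨c₀, hc₀⟩ : ∃ c : ℝ, c = 20 * d + 2 * L := ⟨_, rfl⟩
  refine ⟨√(Real.exp c₀ * S), 4 * d, by positivity, fun t ht i => ?_⟩
  set ℓ := latL1 i with hℓ
  have hℓ0 : 0 ≤ ℓ := latL1_nonneg i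
  set Λ := 2 + ℓ with hΛ
  have hΛ0 : 0 < Λ := by positivity
  have hlog : 0 < Real.log Λ := Real.log_pos (by linarith)
  set w : (Fin d → ℤ) → ℝ := fun j => Real.exp (2 * Real.log Λ * (ℓ - |latL1 j - ℓ|)) with hw
  have hw0 : ∀ j, 0 ≤ w j := fun j => (Real.exp_pos _).le
  have hcomp : ∀ i j, |latL1 i - latL1 j| ≤ 1 → w j ≤ Λ ^ 2 * w i := by
    intro i j hij
    have : Λ ^ 2 = Real.exp (2 * Real.log Λ) := by
      rw [two_mul, Real.exp_add, Real.exp_log hΛ0, sq]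
    rw [hw, this, ← Real.exp_add, Real.exp_le_exp]
    have h3 : |latL1 i - ℓ| ≤ |latL1 i - latL1 j| + |latL1 j - ℓ| := abs_sub_le _ _ _
    nlinarith
  have hws : Summable w := by
    refine Summable.of_nonneg_of_le hw0 (fun j => ?_)
      ((summable_exp_neg_latL1 (mul_pos two_pos hlog) d).mul_left
        (Real.exp (2 * Real.log Λ * (2 * ℓ))))
    rw [← Real.exp_add, hw, Real.exp_le_exp]
    have := le_abs_self (latL1 j - ℓ)
    nlinarith
  have hbd : ∀ x ∈ Set.Icc (0 : ℝ) 1, ∀ j, ‖u x j‖ ≤ √M := fun x hx j =>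
    (norm_le_sqrt_tsum (hu x hx) j).trans (Real.sqrt_le_sqrt (hM x hx))
  have hE := h.weighted_energy_le le_rfl le_rfl hbd hw0 hws hΛ0
    (fun j k => hcomp _ _ (abs_le.mpr ⟨by linarith [le_latL1_add_single j k],
      by linarith [latL1_add_single_le j k]⟩))
    (fun j k => hcomp _ _ (abs_le.mpr ⟨by linarith [le_latL1_sub_single j k],
      by linarith [latL1_sub_single_le j k]⟩))
    (s := 0) (by simp) ht
  have hwle : ∀ j, w j * ‖u 0 j‖ ^ 2 ≤ Real.exp (4 * d * Λ) *
      (Real.exp (2 * μ * latNorm j * Real.log (latNorm j + 1)) * ‖u 0 j‖ ^ 2) := by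
    intro j
    rw [← mul_assoc]
    refine mul_le_mul_of_nonneg_right ?_ (sq_nonneg _)
    rw [← Real.exp_add, hw, Real.exp_le_exp]
    set r := latNorm j
    have hr : 0 ≤ r := latNorm_nonneg j
    have h1 : ℓ - |latL1 j - ℓ| ≤ d * r := by
      have := neg_abs_le (latL1 j - ℓ)
      have := latL1_le_mul_latNorm j
      linarith
    have h2 : 2 * Real.log Λ * (ℓ - |latL1 j - ℓ|) ≤ 2 * Real.log Λ * (d * r) :=
      mul_le_mul_of_nonneg_left h1 (by linarith)
    have hl1 : 0 ≤ Real.log (r + 1) := Real.log_nonneg (by linarith)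
    have h3 : 2 * (2 * d) * r * Real.log (r + 1) ≤ 2 * μ * r * Real.log (r + 1) := by gcongr
    have h4 : r * Real.log Λ - 2 * (r * Real.log (r + 1)) ≤ 2 * Λ := by
      have e1 : Real.log (Λ / (r + 1) ^ 2) = Real.log Λ - 2 * Real.log (r + 1) := by
        rw [Real.log_div hΛ0.ne' (by positivity), Real.log_pow]; norm_num
      have e2 : Real.log (Λ / (r + 1) ^ 2) ≤ Λ / (r + 1) ^ 2 - 1 :=
        Real.log_le_sub_one_of_pos (by positivity)
      have e3 : r * (Λ / (r + 1) ^ 2) ≤ Λ := by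
        rw [← mul_div_assoc, div_le_iff₀ (by positivity)]
        nlinarith [mul_nonneg hr hΛ0.le, mul_nonneg (mul_nonneg hr hr) hΛ0.le]
      nlinarith
    have hd0 : (0 : ℝ) ≤ d := by positivity
    nlinarith
  have hsw : Summable fun j => w j * ‖u 0 j‖ ^ 2 :=
    Summable.of_nonneg_of_le (fun j => mul_nonneg (hw0 j) (sq_nonneg _)) hwle (h0.mul_left _)
  have hsw' : Summable fun j => w j * ‖u t j‖ ^ 2 := by
    refine Summable.of_nonneg_of_le (fun j => mul_nonneg (hw0 j) (sq_nonneg _)) (fun j => ?_)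
      (hws.mul_right (√M ^ 2))
    have := hbd t ht j
    have := hw0 j
    gcongr
  have h5 : w i * ‖u t i‖ ^ 2 ≤ Real.exp (4 * d * Λ + 4 * d + 2 * L) * (Real.exp (4 * d * Λ) * S) :=
    (hsw'.le_tsum i fun j _ => mul_nonneg (hw0 j) (sq_nonneg _)).trans <| hE.trans <|
      mul_le_mul_of_nonneg_left
        ((Summable.tsum_le_tsum hwle hsw (h0.mul_left _)).trans_eq tsum_mul_left)
        (Real.exp_pos _).le
  have hwi : w i = Real.exp (2 * Real.log Λ * ℓ) := by rw [hw]; simp [← hℓ]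
  have hS : 0 ≤ S := tsum_nonneg fun j => by positivity
  have h6 : ‖u t i‖ ^ 2 ≤ Real.exp c₀ * S *
      Real.exp (4 * d * ℓ - ℓ * Real.log (1 + ℓ)) ^ 2 := by
    have hpos : 0 < w i := Real.exp_pos _
    refine le_of_mul_le_mul_left (h5.trans ?_) hpos
    rw [hwi, sq, ← Real.exp_add]
    have e1 : Real.exp (2 * Real.log Λ * ℓ) * (Real.exp c₀ * S *
        Real.exp (4 * d * ℓ - ℓ * Real.log (1 + ℓ) + (4 * d * ℓ - ℓ * Real.log (1 + ℓ)))) =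
        Real.exp (2 * Real.log Λ * ℓ + c₀ + (4 * d * ℓ - ℓ * Real.log (1 + ℓ)
          + (4 * d * ℓ - ℓ * Real.log (1 + ℓ)))) * S := by
      simp only [Real.exp_add]; ring
    rw [e1, ← mul_assoc, ← Real.exp_add]
    refine mul_le_mul_of_nonneg_right (Real.exp_le_exp.mpr ?_) hS
    have : Real.log (1 + ℓ) ≤ Real.log Λ := Real.log_le_log (by linarith) (by linarith)
    have hd0 : (0 : ℝ) ≤ d := by positivity
    have h8 := mul_nonneg hℓ0 (sub_nonneg.mpr this)
    rw [hc₀]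
    have h9 : 4 * d * Λ = 8 * d + 4 * d * ℓ := by rw [hΛ]; ring
    nlinarith
  have h7 := Real.sqrt_le_sqrt h6
  rwa [Real.sqrt_sq (norm_nonneg _), Real.sqrt_mul (by positivity),
    Real.sqrt_sq (Real.exp_pos _).le] at h7

end IsPerturbedSolution

section RapidDecay

variable {d : ℕ} {E : Type*} [NormedAddCommGroup E]

/-- Faster than exponential decay in space, uniformly for times in `[0,1]`. -/
def RapidlyDecaying (F : ℝ → (Fin d → ℤ) → E) : Prop :=
  ∀ p : ℝ, ∃ C : ℝ, ∀ t ∈ Set.Icc (0 : ℝ) 1, ∀ j, ‖F t j‖ ≤ C * Real.exp (-p * latL1 j)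

/-- At most exponential growth in space, uniformly for times in `[0,1]`. -/
def Tempered (c : ℝ → (Fin d → ℤ) → ℝ) : Prop :=
  ∃ p C : ℝ, ∀ t ∈ Set.Icc (0 : ℝ) 1, ∀ j, |c t j| ≤ C * Real.exp (p * latL1 j)

theorem Tempered.exists_nonneg {c : ℝ → (Fin d → ℤ) → ℝ} (hc : Tempered c) :
    ∃ p C : ℝ, 0 ≤ p ∧ 0 ≤ C ∧
      ∀ t ∈ Set.Icc (0 : ℝ) 1, ∀ j, |c t j| ≤ C * Real.exp (p * latL1 j) := by
  obtain ⟨p, C, h⟩ := hc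
  refine ⟨|p|, |C|, abs_nonneg _, abs_nonneg _, fun t ht j => (h t ht j).trans ?_⟩
  have := latL1_nonneg j
  gcongr
  · exact le_abs_self _
  · exact le_abs_self _

theorem Tempered.add {c c' : ℝ → (Fin d → ℤ) → ℝ} (hc : Tempered c) (hc' : Tempered c') :
    Tempered fun t j => c t j + c' t j := by
  obtain ⟨p, C, hp, hC, h⟩ := hc.exists_nonneg
  obtain ⟨p', C', hp', hC', h'⟩ := hc'.exists_nonneg
  refine ⟨p + p', C + C', fun t ht j => (abs_add_le _ _).trans ?_⟩
  have hj := latL1_nonneg j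
  have h1 : Real.exp (p * latL1 j) ≤ Real.exp ((p + p') * latL1 j) :=
    Real.exp_le_exp.mpr (by nlinarith)
  have h2 : Real.exp (p' * latL1 j) ≤ Real.exp ((p + p') * latL1 j) :=
    Real.exp_le_exp.mpr (by nlinarith)
  have := h t ht j
  have := h' t ht j
  nlinarith

theorem Tempered.mul {c c' : ℝ → (Fin d → ℤ) → ℝ} (hc : Tempered c) (hc' : Tempered c') :
    Tempered fun t j => c t j * c' t j := by
  obtain ⟨p, C, hp, hC, h⟩ := hc.exists_nonneg
  obtain ⟨p', C', hp', hC', h'⟩ := hc'.exists_nonneg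
  refine ⟨p + p', C * C', fun t ht j => ?_⟩
  rw [abs_mul, add_mul, Real.exp_add, mul_mul_mul_comm]
  exact mul_le_mul (h t ht j) (h' t ht j) (abs_nonneg _) (by positivity)

theorem Tempered.const (r : ℝ) : Tempered fun _ (_ : Fin d → ℤ) => r :=
  ⟨0, |r|, fun t _ j => by simp⟩

theorem Tempered.neg {c : ℝ → (Fin d → ℤ) → ℝ} (hc : Tempered c) :
    Tempered fun t j => -c t j := by
  simpa using (Tempered.const (-1)).mul hc

theorem Tempered.sub {c c' : ℝ → (Fin d → ℤ) → ℝ} (hc : Tempered c) (hc' : Tempered c') :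
    Tempered fun t j => c t j - c' t j := by
  simpa [sub_eq_add_neg] using hc.add hc'.neg

theorem Tempered.abs {c : ℝ → (Fin d → ℤ) → ℝ} (hc : Tempered c) :
    Tempered fun t j => |c t j| := by
  obtain ⟨p, C, h⟩ := hc
  exact ⟨p, C, fun t ht j => by simpa using h t ht j⟩

theorem Tempered.translate {c : ℝ → (Fin d → ℤ) → ℝ} (hc : Tempered c) (v : Fin d → ℤ) :
    Tempered fun t j => c t (j + v) := by
  obtain ⟨p, C, hp, hC, h⟩ := hc.exists_nonneg
  refine ⟨p, C * Real.exp (p * latL1 v), fun t ht j => (h t ht _).trans ?_⟩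
  rw [mul_assoc, ← Real.exp_add]
  gcongr
  have := latL1_add_le j v
  nlinarith

theorem RapidlyDecaying.add {F G : ℝ → (Fin d → ℤ) → E} (hF : RapidlyDecaying F)
    (hG : RapidlyDecaying G) : RapidlyDecaying fun t j => F t j + G t j := by
  intro p
  obtain ⟨C, h⟩ := hF p
  obtain ⟨C', h'⟩ := hG p
  refine ⟨C + C', fun t ht j => (norm_add_le _ _).trans ?_⟩
  rw [add_mul]
  exact add_le_add (h t ht j) (h' t ht j)

theorem RapidlyDecaying.of_norm_le {E' : Type*} [NormedAddCommGroup E']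
    {F : ℝ → (Fin d → ℤ) → E} {G : ℝ → (Fin d → ℤ) → E'}
    (hF : RapidlyDecaying F) (h : ∀ t ∈ Set.Icc (0 : ℝ) 1, ∀ j, ‖G t j‖ ≤ ‖F t j‖) :
    RapidlyDecaying G := by
  intro p
  obtain ⟨C, hC⟩ := hF p
  exact ⟨C, fun t ht j => (h t ht j).trans (hC t ht j)⟩

theorem RapidlyDecaying.translate {F : ℝ → (Fin d → ℤ) → E} (hF : RapidlyDecaying F)
    (v : Fin d → ℤ) : RapidlyDecaying fun t j => F t (j + v) := by
  intro p
  obtain ⟨C, h⟩ := hF |p|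
  refine ⟨|C| * Real.exp (|p| * latL1 v), fun t ht j => (h t ht _).trans ?_⟩
  rw [mul_assoc, ← Real.exp_add]
  have h1 := latL1_sub_le (j + v) v
  rw [add_sub_cancel_right] at h1
  gcongr
  · exact le_abs_self _
  · have := latL1_nonneg j
    nlinarith [le_abs_self p, abs_nonneg p]

theorem RapidlyDecaying.smul [NormedSpace ℝ E] {F : ℝ → (Fin d → ℤ) → E}
    (hF : RapidlyDecaying F) {c : ℝ → (Fin d → ℤ) → ℝ} (hc : Tempered c) :
    RapidlyDecaying fun t j => c t j • F t j := by
  intro p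
  obtain ⟨q, C', hq, hC', h'⟩ := hc.exists_nonneg
  obtain ⟨C, h⟩ := hF (p + q)
  refine ⟨C' * C, fun t ht j => ?_⟩
  rw [norm_smul, Real.norm_eq_abs]
  have e : C' * C * Real.exp (-p * latL1 j) =
      (C' * Real.exp (q * latL1 j)) * (C * Real.exp (-(p + q) * latL1 j)) := by
    rw [mul_mul_mul_comm, ← Real.exp_add]; ring_nf
  rw [e]
  exact mul_le_mul (h' t ht j) (h t ht j) (norm_nonneg _) (by positivity)

theorem RapidlyDecaying.sum {κ : Type*} (s : Finset κ) {F : κ → ℝ → (Fin d → ℤ) → E}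
    (hF : ∀ k ∈ s, RapidlyDecaying (F k)) : RapidlyDecaying fun t j => ∑ k ∈ s, F k t j := by
  classical
  induction s using Finset.induction_on with
  | empty => exact fun p => ⟨0, by simp⟩
  | insert k s hk ih =>
    simp only [Finset.sum_insert hk]
    exact (hF k (by simp)).add (ih fun k' h' => hF k' (by simp [h']))

theorem RapidlyDecaying.inner {F G : ℝ → (Fin d → ℤ) → ℂ} (hF : RapidlyDecaying F)
    (hG : RapidlyDecaying G) : RapidlyDecaying fun t j => inner ℝ (F t j) (G t j) := by
  obtain ⟨C', h'⟩ := hG 0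
  intro p
  obtain ⟨C, h⟩ := hF p
  refine ⟨C * C', fun t ht j => (abs_real_inner_le_norm _ _).trans ?_⟩
  have h1 := h t ht j
  have h2 := h' t ht j
  simp only [neg_zero, zero_mul, Real.exp_zero, mul_one] at h2
  calc ‖F t j‖ * ‖G t j‖ ≤ (C * Real.exp (-p * latL1 j)) * C' :=
        mul_le_mul h1 h2 (norm_nonneg _) ((norm_nonneg _).trans h1)
    _ = _ := by ring

theorem RapidlyDecaying.exists_summable_bound {F : ℝ → (Fin d → ℤ) → E}
    (hF : RapidlyDecaying F) : ∃ B : (Fin d → ℤ) → ℝ, Summable B ∧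
      ∀ t ∈ Set.Icc (0 : ℝ) 1, ∀ j, ‖F t j‖ ≤ B j := by
  obtain ⟨C, h⟩ := hF 1
  exact ⟨_, (summable_exp_neg_latL1 one_pos d).mul_left C, h⟩

theorem RapidlyDecaying.summable {F : ℝ → (Fin d → ℤ) → ℝ} (hF : RapidlyDecaying F) {t : ℝ}
    (ht : t ∈ Set.Icc (0 : ℝ) 1) : Summable (F t) := by
  obtain ⟨B, hB, h⟩ := hF.exists_summable_bound
  exact Summable.of_norm_bounded hB (h t ht)

/-- The real inner product of `ℓ²(ℤ^d)`. -/
noncomputable def latInner (f g : (Fin d → ℤ) → ℂ) : ℝ := ∑' j, inner ℝ (f j) (g j)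

theorem latInner_comm (f g : (Fin d → ℤ) → ℂ) : latInner f g = latInner g f := by
  simp only [latInner, real_inner_comm]

variable {F G F' G' K : ℝ → (Fin d → ℤ) → ℂ} {t : ℝ}

theorem latInner_add_right (hF : RapidlyDecaying F) (hG : RapidlyDecaying G)
    (hK : RapidlyDecaying K) (ht : t ∈ Set.Icc (0 : ℝ) 1) :
    latInner (F t) (fun j => G t j + K t j) = latInner (F t) (G t) + latInner (F t) (K t) := by
  simp only [latInner, inner_add_right]
  exact ((hF.inner hG).summable ht).tsum_add ((hF.inner hK).summable ht)

theorem latInner_add_left (hF : RapidlyDecaying F) (hG : RapidlyDecaying G)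
    (hK : RapidlyDecaying K) (ht : t ∈ Set.Icc (0 : ℝ) 1) :
    latInner (fun j => G t j + K t j) (F t) = latInner (G t) (F t) + latInner (K t) (F t) := by
  rw [latInner_comm, latInner_add_right hF hG hK ht, latInner_comm, latInner_comm (F t)]

theorem continuousOn_latInner (hF : RapidlyDecaying F) (hG : RapidlyDecaying G)
    (hFc : ∀ j, ContinuousOn (fun t => F t j) (Set.Icc 0 1))
    (hGc : ∀ j, ContinuousOn (fun t => G t j) (Set.Icc 0 1)) :
    ContinuousOn (fun t => latInner (F t) (G t)) (Set.Icc 0 1) := by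
  obtain ⟨B, hB, h⟩ := (hF.inner hG).exists_summable_bound
  exact continuousOn_tsum (fun j => (hFc j).inner (𝕜 := ℝ) (hGc j)) hB fun j t ht => h t ht j

theorem hasDerivAt_latInner (hF : RapidlyDecaying F) (hG : RapidlyDecaying G)
    (hF' : RapidlyDecaying F') (hG' : RapidlyDecaying G')
    (hFd : ∀ j, ∀ t ∈ Set.Ioo (0 : ℝ) 1, HasDerivAt (fun t => F t j) (F' t j) t)
    (hGd : ∀ j, ∀ t ∈ Set.Ioo (0 : ℝ) 1, HasDerivAt (fun t => G t j) (G' t j) t)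
    (ht : t ∈ Set.Ioo (0 : ℝ) 1) :
    HasDerivAt (fun t => latInner (F t) (G t))
      (latInner (F t) (G' t) + latInner (F' t) (G t)) t := by
  have ht' := Set.Ioo_subset_Icc_self ht
  have hr := (hF.inner hG').add (hF'.inner hG)
  obtain ⟨B, hB, h⟩ := hr.exists_summable_bound
  have := hasDerivAt_tsum_of_isPreconnected hB isOpen_Ioo isPreconnected_Ioo
    (fun j y hy => (hFd j y hy).inner ℝ (hGd j y hy))
    (fun j y hy => h y (Set.Ioo_subset_Icc_self hy) j) ht ((hF.inner hG).summable ht') ht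
  rwa [((hF.inner hG').summable ht').tsum_add ((hF'.inner hG).summable ht')] at this

theorem RapidlyDecaying.tsum_translate {F : ℝ → (Fin d → ℤ) → ℝ} (hF : RapidlyDecaying F)
    (ht : t ∈ Set.Icc (0 : ℝ) 1) (v : Fin d → ℤ) : ∑' j, F t (j - v) = ∑' j, F t j :=
  ((hF.summable ht).hasSum.comp_sub_right v).tsum_eq

end RapidDecay

section Hopping

variable {d : ℕ}

/-- The symmetric first-order operator `f ↦ i (c_{j-e} f_{j-e} - c_j f_{j+e})`, `e = e_k`. -/
noncomputable def symHop (k : Fin d) (c : (Fin d → ℤ) → ℝ) (f : (Fin d → ℤ) → ℂ)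
    (j : Fin d → ℤ) : ℂ :=
  Complex.I * (c (j - Pi.single k 1) • f (j - Pi.single k 1) - c j • f (j + Pi.single k 1))

/-- The antisymmetric operator `f ↦ i (c_j f_{j+e} + c_{j-e} f_{j-e})`, `e = e_k`. -/
noncomputable def skewHop (k : Fin d) (c : (Fin d → ℤ) → ℝ) (f : (Fin d → ℤ) → ℂ)
    (j : Fin d → ℤ) : ℂ :=
  Complex.I * (c j • f (j + Pi.single k 1) + c (j - Pi.single k 1) • f (j - Pi.single k 1))

/-- Multiplication by `p` plus symmetric hopping with coefficient `c`. -/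
noncomputable def symOp (k : Fin d) (p c : (Fin d → ℤ) → ℝ) (f : (Fin d → ℤ) → ℂ)
    (j : Fin d → ℤ) : ℂ :=
  p j • f j + symHop k c f j

/-- The part of `i Δ_d` not acting as a shift in direction `k₀`. -/
noncomputable def transverseOp (k₀ : Fin d) (f : (Fin d → ℤ) → ℂ) (j : Fin d → ℤ) : ℂ :=
  (∑ k ∈ Finset.univ.erase k₀, skewHop k (fun _ => 1) f j) + (-2 * d : ℝ) • (Complex.I * f j)

theorem Tempered.translate_sub {c : ℝ → (Fin d → ℤ) → ℝ} (hc : Tempered c) (v : Fin d → ℤ) :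
    Tempered fun t j => c t (j - v) := by
  simpa only [sub_eq_add_neg] using hc.translate (-v)

theorem RapidlyDecaying.translate_sub {E : Type*} [NormedAddCommGroup E]
    {F : ℝ → (Fin d → ℤ) → E} (hF : RapidlyDecaying F)
    (v : Fin d → ℤ) : RapidlyDecaying fun t j => F t (j - v) := by
  simpa only [sub_eq_add_neg] using hF.translate (-v)

theorem RapidlyDecaying.I_mul {F : ℝ → (Fin d → ℤ) → ℂ} (hF : RapidlyDecaying F) :
    RapidlyDecaying fun t j => Complex.I * F t j :=
  hF.of_norm_le fun t _ j => by simp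

theorem RapidlyDecaying.neg {E : Type*} [NormedAddCommGroup E] {F : ℝ → (Fin d → ℤ) → E}
    (hF : RapidlyDecaying F) : RapidlyDecaying fun t j => -F t j :=
  hF.of_norm_le fun t _ j => by simp

theorem RapidlyDecaying.sub {E : Type*} [NormedAddCommGroup E] {F G : ℝ → (Fin d → ℤ) → E}
    (hF : RapidlyDecaying F) (hG : RapidlyDecaying G) :
    RapidlyDecaying fun t j => F t j - G t j := by
  simpa only [sub_eq_add_neg] using hF.add hG.neg

variable {f g : ℝ → (Fin d → ℤ) → ℂ} {a b c p q s τ : ℝ → (Fin d → ℤ) → ℝ} {t : ℝ}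

theorem RapidlyDecaying.symHop (hf : RapidlyDecaying f) (hc : Tempered c) (k : Fin d) :
    RapidlyDecaying fun t => symHop k (c t) (f t) :=
  RapidlyDecaying.I_mul (((hf.smul hc).translate_sub (Pi.single k 1)).sub
    ((hf.translate (Pi.single k 1)).smul hc))

theorem RapidlyDecaying.skewHop (hf : RapidlyDecaying f) (hc : Tempered c) (k : Fin d) :
    RapidlyDecaying fun t => skewHop k (c t) (f t) :=
  RapidlyDecaying.I_mul (((hf.translate (Pi.single k 1)).smul hc).add
    ((hf.smul hc).translate_sub (Pi.single k 1)))

theorem RapidlyDecaying.symOp (hf : RapidlyDecaying f) (hp : Tempered p) (hc : Tempered c)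
    (k : Fin d) : RapidlyDecaying fun t => symOp k (p t) (c t) (f t) :=
  (hf.smul hp).add (hf.symHop hc k)

theorem RapidlyDecaying.transverseOp (hf : RapidlyDecaying f) (k : Fin d) :
    RapidlyDecaying fun t => transverseOp k (f t) :=
  (RapidlyDecaying.sum _ fun k _ => hf.skewHop (Tempered.const 1) k).add
    (hf.I_mul.smul (Tempered.const _))

theorem RapidlyDecaying.tsum_le_of_telescope {P Q Y : ℝ → (Fin d → ℤ) → ℝ}
    (hP : RapidlyDecaying P) (hQ : RapidlyDecaying Q) (hY : RapidlyDecaying Y)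
    (ht : t ∈ Set.Icc (0 : ℝ) 1) (v : Fin d → ℤ)
    (h : ∀ j, P t j + (Y t (j - v) - Y t j) ≤ Q t j) : ∑' j, P t j ≤ ∑' j, Q t j := by
  have hs := (hY.translate_sub v).summable ht
  have h1 := Summable.tsum_le_tsum h
    ((hP.summable ht).add (hs.sub (hY.summable ht))) (hQ.summable ht)
  rw [(hP.summable ht).tsum_add (hs.sub (hY.summable ht)), hs.tsum_sub (hY.summable ht),
    hY.tsum_translate ht v] at h1
  linarith

theorem RapidlyDecaying.tsum_eq_of_telescope {P Q Y : ℝ → (Fin d → ℤ) → ℝ}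
    (hP : RapidlyDecaying P) (hQ : RapidlyDecaying Q) (hY : RapidlyDecaying Y)
    (ht : t ∈ Set.Icc (0 : ℝ) 1) (v : Fin d → ℤ)
    (h : ∀ j, P t j + (Y t (j - v) - Y t j) = Q t j) : ∑' j, P t j = ∑' j, Q t j := by
  refine le_antisymm (hP.tsum_le_of_telescope hQ hY ht v fun j => (h j).le)
    (hQ.tsum_le_of_telescope hP hY.neg ht v fun j => ?_)
  linarith [h j]

theorem latInner_symHop (hf : RapidlyDecaying f) (hg : RapidlyDecaying g) (hc : Tempered c)
    (k : Fin d) (ht : t ∈ Set.Icc (0 : ℝ) 1) :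
    latInner (symHop k (c t) (f t)) (g t) = latInner (f t) (symHop k (c t) (g t)) := by
  refine RapidlyDecaying.tsum_eq_of_telescope (hf.symHop hc k |>.inner hg)
    (hf.inner (hg.symHop hc k))
    (Y := fun t j => inner ℝ (Complex.I * c t j • f t (j + Pi.single k 1)) (-g t j) -
      inner ℝ (Complex.I * c t j • f t j) (g t (j + Pi.single k 1))) ?_ ht (Pi.single k 1) ?_
  · exact (((hf.translate (Pi.single k 1)).smul hc).I_mul.inner hg.neg).sub
      ((hf.smul hc).I_mul.inner (hg.translate (Pi.single k 1)))
  · intro j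
    simp only [symHop, Complex.inner, sub_add_cancel]
    simp
    ring

theorem latInner_skewHop (hf : RapidlyDecaying f) (hg : RapidlyDecaying g) (hc : Tempered c)
    (k : Fin d) (ht : t ∈ Set.Icc (0 : ℝ) 1) :
    latInner (skewHop k (c t) (f t)) (g t) = -latInner (f t) (skewHop k (c t) (g t)) := by
  rw [latInner, latInner, ← tsum_neg]
  refine RapidlyDecaying.tsum_eq_of_telescope (hf.skewHop hc k |>.inner hg)
    (hf.inner (hg.skewHop hc k)).neg
    (Y := fun t j => inner ℝ (Complex.I * c t j • f t (j + Pi.single k 1)) (g t j) -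
      inner ℝ (Complex.I * c t j • f t j) (g t (j + Pi.single k 1))) ?_ ht (Pi.single k 1) ?_
  · exact (((hf.translate (Pi.single k 1)).smul hc).I_mul.inner hg).sub
      ((hf.smul hc).I_mul.inner (hg.translate (Pi.single k 1)))
  · intro j
    simp only [skewHop, Complex.inner, sub_add_cancel]
    simp
    ring

theorem latInner_symOp (hf : RapidlyDecaying f) (hg : RapidlyDecaying g) (hp : Tempered p)
    (hc : Tempered c) (k : Fin d) (ht : t ∈ Set.Icc (0 : ℝ) 1) :
    latInner (symOp k (p t) (c t) (f t)) (g t) = latInner (f t) (symOp k (p t) (c t) (g t)) := by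
  have h1 := latInner_add_left hg (hf.smul hp) (hf.symHop hc k) ht
  have h2 := latInner_add_right hf (hg.smul hp) (hg.symHop hc k) ht
  unfold symOp
  rw [h1, h2, latInner_symHop hf hg hc k ht]
  congr 1
  simp only [latInner, real_inner_smul_left, real_inner_smul_right]

theorem inner_I_mul_left (z w : ℂ) : inner ℝ (Complex.I * z) w = -inner ℝ z (Complex.I * w) := by
  simp [Complex.inner]; ring

theorem latInner_I_mul_left (f g : (Fin d → ℤ) → ℂ) :
    latInner (fun j => Complex.I * f j) g = -latInner f fun j => Complex.I * g j := by
  simp only [latInner, inner_I_mul_left, tsum_neg]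

theorem symOp_I_mul (k : Fin d) (p c : (Fin d → ℤ) → ℝ) (f : (Fin d → ℤ) → ℂ) :
    symOp k p c (fun j => Complex.I * f j) = fun j => Complex.I * symOp k p c f j := by
  ext j
  simp only [symOp, symHop, Complex.real_smul]
  ring

theorem symOp_skewHop {k l : Fin d} {p c : (Fin d → ℤ) → ℝ} (f : (Fin d → ℤ) → ℂ)
    (hp : ∀ j, p (j + Pi.single l 1) = p j) (hc : ∀ j, c (j + Pi.single l 1) = c j) :
    symOp k p c (skewHop l (fun _ => 1) f) = skewHop l (fun _ => 1) (symOp k p c f) := by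
  have hp' : ∀ j, p (j - Pi.single l 1) = p j := fun j => by
    rw [← hp (j - Pi.single l 1), sub_add_cancel]
  have hc' : ∀ j, c (j - Pi.single l 1) = c j := fun j => by
    rw [← hc (j - Pi.single l 1), sub_add_cancel]
  ext j
  simp only [symOp, symHop, skewHop, Complex.real_smul, hp, hc, hp', hc']
  generalize hv : (Pi.single l 1 : Fin d → ℤ) = v at *
  generalize (Pi.single k 1 : Fin d → ℤ) = w
  rw [sub_right_comm j v w, add_right_comm j v w, add_sub_right_comm j v w,
    ← add_sub_right_comm j w v, hc, hc']
  push_cast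
  ring

theorem latInner_symOp_skewHop_eq_zero (hf : RapidlyDecaying f) (hp : Tempered p)
    (hc : Tempered c) {k l : Fin d} (ht : t ∈ Set.Icc (0 : ℝ) 1)
    (hpl : ∀ j, p t (j + Pi.single l 1) = p t j) (hcl : ∀ j, c t (j + Pi.single l 1) = c t j) :
    latInner (symOp k (p t) (c t) (f t)) (skewHop l (fun _ => 1) (f t)) = 0 := by
  have h1 := latInner_skewHop (hf.symOp hp hc k) hf (Tempered.const 1) l ht
  rw [← symOp_skewHop (f t) hpl hcl,
    latInner_symOp (hf.skewHop (Tempered.const 1) l) hf hp hc k ht, latInner_comm] at h1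
  linarith

theorem latInner_symOp_I_mul_eq_zero (hf : RapidlyDecaying f) (hp : Tempered p)
    (hc : Tempered c) (k : Fin d) (ht : t ∈ Set.Icc (0 : ℝ) 1) :
    latInner (symOp k (p t) (c t) (f t)) (fun j => Complex.I * f t j) = 0 := by
  have h1 := latInner_symOp hf.I_mul hf hp hc k ht
  rw [symOp_I_mul, latInner_I_mul_left, latInner_I_mul_left] at h1
  have h2 := latInner_symOp hf hf.I_mul hp hc k ht
  rw [symOp_I_mul] at h2
  have h3 := latInner_I_mul_left (f t) (symOp k (p t) (c t) (f t))
  rw [latInner_comm] at h3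
  linarith

theorem latInner_symOp_transverseOp_eq_zero (hf : RapidlyDecaying f) (hp : Tempered p)
    (hc : Tempered c) {k : Fin d} (ht : t ∈ Set.Icc (0 : ℝ) 1)
    (hpl : ∀ l ≠ k, ∀ j, p t (j + Pi.single l 1) = p t j)
    (hcl : ∀ l ≠ k, ∀ j, c t (j + Pi.single l 1) = c t j) :
    latInner (symOp k (p t) (c t) (f t)) (transverseOp k (f t)) = 0 := by
  have hS := hf.symOp hp hc k
  unfold transverseOp
  rw [latInner_add_right hS
    (RapidlyDecaying.sum _ fun k _ => hf.skewHop (Tempered.const 1) k)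
    (hf.I_mul.smul (Tempered.const _)) ht]
  have h1 := latInner_symOp_I_mul_eq_zero hf hp hc k ht
  simp only [latInner, inner_sum, real_inner_smul_right, tsum_mul_left] at h1 ⊢
  rw [h1, Summable.tsum_finsetSum fun l _ =>
    ((hS.inner (hf.skewHop (Tempered.const 1) l)).summable ht), mul_zero, add_zero]
  exact Finset.sum_eq_zero fun l hl => latInner_symOp_skewHop_eq_zero hf hp hc ht
    (hpl l (Finset.ne_of_mem_erase hl)) (hcl l (Finset.ne_of_mem_erase hl))

theorem virial_density_le {a₀ a₁ b₀ b₁ p₁ p₂ q s₀ s₁ s₂ τ₀ τ₁ : ℝ} (f₀ f₁ f₂ : ℂ)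
    (hs : s₁ = a₁ * b₀ - a₀ * b₁) (hs1 : 0 ≤ s₁) (hτ : τ₁ = (p₂ - p₁) * b₁)
    (hm : 0 ≤ q + 2 * a₁ * b₁ - 2 * a₀ * b₀ - 2 * |τ₁| - 2 * |τ₀| - s₂ - s₀) :
    0 + ((τ₀ * inner ℝ (Complex.I * f₀) f₁ + 2 * p₁ * b₀ * inner ℝ (Complex.I * f₀) f₁
        + 2 * a₀ * b₀ * (‖f₀‖ ^ 2 + ‖f₁‖ ^ 2) + 2 * |τ₀| * ‖f₁‖ ^ 2
        - s₁ * ‖f₀‖ ^ 2 + s₀ * ‖f₁‖ ^ 2)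
      - (τ₁ * inner ℝ (Complex.I * f₁) f₂ + 2 * p₂ * b₁ * inner ℝ (Complex.I * f₁) f₂
        + 2 * a₁ * b₁ * (‖f₁‖ ^ 2 + ‖f₂‖ ^ 2) + 2 * |τ₁| * ‖f₂‖ ^ 2
        - s₂ * ‖f₁‖ ^ 2 + s₁ * ‖f₂‖ ^ 2)) ≤
      inner ℝ f₁ (q • f₁ + Complex.I * (τ₀ • f₀ - τ₁ • f₂)) +
      2 * inner ℝ (p₁ • f₁ + Complex.I * (a₀ • f₀ - a₁ • f₂))
        (Complex.I * (b₁ • f₂ + b₀ • f₀)) := by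
  obtain ⟨x₀, y₀⟩ := f₀
  obtain ⟨x₁, y₁⟩ := f₁
  obtain ⟨x₂, y₂⟩ := f₂
  simp only [Complex.inner, Complex.sq_norm, Complex.normSq_apply]
  simp
  have h1 := mul_nonneg hm (add_nonneg (sq_nonneg x₁) (sq_nonneg y₁))
  have h2 := mul_nonneg hs1 (add_nonneg (sq_nonneg (x₀ - x₂)) (sq_nonneg (y₀ - y₂)))
  have h3 := mul_nonneg (abs_nonneg τ₁) (add_nonneg (sq_nonneg (x₁ - y₂)) (sq_nonneg (y₁ + x₂)))
  have h3' := mul_nonneg (abs_nonneg τ₁) (add_nonneg (sq_nonneg (x₁ + y₂)) (sq_nonneg (y₁ - x₂)))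
  have h4 : |4 * (τ₁ * (x₁ * y₂ - y₁ * x₂))| ≤
      2 * |τ₁| * (x₁ ^ 2 + y₁ ^ 2 + x₂ ^ 2 + y₂ ^ 2) := by
    rw [abs_mul, abs_mul, abs_of_pos (by norm_num : (0 : ℝ) < 4)]
    have : |x₁ * y₂ - y₁ * x₂| ≤ (x₁ ^ 2 + y₁ ^ 2 + x₂ ^ 2 + y₂ ^ 2) / 2 :=
      abs_le.mpr ⟨by nlinarith [sq_nonneg (x₁ + y₂), sq_nonneg (y₁ - x₂)],
        by nlinarith [sq_nonneg (x₁ - y₂), sq_nonneg (y₁ + x₂)]⟩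
    nlinarith [abs_nonneg τ₁]
  have h5 := neg_le_of_abs_le h4
  subst hs
  rw [hτ] at h5 ⊢
  rw [hτ] at h1
  nlinarith

end Hopping

section LogConvexity

variable {d : ℕ}

theorem virial_nonneg {f : ℝ → (Fin d → ℤ) → ℂ} {a b p q τ s : ℝ → (Fin d → ℤ) → ℝ}
    (hf : RapidlyDecaying f) (ha : Tempered a) (hb : Tempered b) (hp : Tempered p)
    (hq : Tempered q) (hτ : Tempered τ) (hs : Tempered s) {k : Fin d} {t : ℝ}
    (ht : t ∈ Set.Icc (0 : ℝ) 1)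
    (hsab : ∀ j, s t j = a t j * b t (j - Pi.single k 1) - a t (j - Pi.single k 1) * b t j)
    (hs0 : ∀ j, 0 ≤ s t j)
    (hτpb : ∀ j, τ t j = (p t (j + Pi.single k 1) - p t j) * b t j)
    (hm : ∀ j, 0 ≤ q t j + 2 * a t j * b t j
      - 2 * a t (j - Pi.single k 1) * b t (j - Pi.single k 1) - 2 * |τ t j|
      - 2 * |τ t (j - Pi.single k 1)| - s t (j + Pi.single k 1) - s t (j - Pi.single k 1)) :
    0 ≤ latInner (f t) (symOp k (q t) (τ t) (f t)) +
      2 * latInner (symOp k (p t) (a t) (f t)) (skewHop k (b t) (f t)) := by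
  have hQ1 := hf.inner (hf.symOp hq hτ k)
  have hQ2 := (hf.symOp hp ha k).inner (hf.skewHop hb k)
  have hf1 := hf.translate (Pi.single k 1)
  have hUf := hf.I_mul.inner hf1
  have hsq : ∀ {F : ℝ → (Fin d → ℤ) → ℂ}, RapidlyDecaying F →
      RapidlyDecaying fun t j => ‖F t j‖ ^ 2 := fun hF => by
    simpa only [real_inner_self_eq_norm_sq] using hF.inner hF
  have hY := (((((hUf.smul hτ).add (hUf.smul (((Tempered.const 2).mul
      (hp.translate (Pi.single k 1))).mul hb))).add
      (((hsq hf).add (hsq hf1)).smul (((Tempered.const 2).mul ha).mul hb))).add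
      ((hsq hf1).smul ((Tempered.const 2).mul hτ.abs))).sub
      ((hsq hf).smul (hs.translate (Pi.single k 1)))).add ((hsq hf1).smul hs)
  have h := RapidlyDecaying.tsum_le_of_telescope
    (P := fun _ (_ : Fin d → ℤ) => (0 : ℝ)) (fun p => ⟨0, by simp⟩)
    (hQ1.add (hQ2.smul (Tempered.const 2))) hY ht (Pi.single k 1) (fun j => by
      have h1 := virial_density_le (f t (j - Pi.single k 1)) (f t j) (f t (j + Pi.single k 1))
        (hsab j) (hs0 j) (hτpb j) (hm j)
      simpa only [smul_eq_mul, sub_add_cancel, symOp, symHop, skewHop] using h1)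
  rw [tsum_zero] at h
  simp only [smul_eq_mul] at h
  rw [(hQ1.summable ht).tsum_add ((hQ2.summable ht).mul_left 2), tsum_mul_left] at h
  exact h

theorem log_convexity_of_frequency {H D H' D' : ℝ → ℝ} {L : ℝ}
    (hHc : ContinuousOn H (Set.Icc 0 1)) (hDc : ContinuousOn D (Set.Icc 0 1))
    (hH : ∀ t ∈ Set.Ioo (0 : ℝ) 1, HasDerivAt H (H' t) t)
    (hD : ∀ t ∈ Set.Ioo (0 : ℝ) 1, HasDerivAt D (D' t) t)
    (hpos : ∀ t ∈ Set.Icc (0 : ℝ) 1, 0 < H t)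
    (h1 : ∀ t ∈ Set.Ioo (0 : ℝ) 1, |H' t - 2 * D t| ≤ 2 * L * H t)
    (h2 : ∀ t ∈ Set.Ioo (0 : ℝ) 1, -(L ^ 2 / 2) * H t ^ 2 ≤ D' t * H t - D t * H' t) :
    H (1 / 2) ^ 2 ≤ Real.exp (L ^ 2 / 2 + 2 * L) * (H 0 * H 1) := by
  have hIoo : ∀ t ∈ Set.Ioo (0 : ℝ) 1, 0 < H t := fun t ht => hpos t (Set.Ioo_subset_Icc_self ht)
  have hN : MonotoneOn (fun t => D t / H t + L ^ 2 / 2 * t) (Set.Icc 0 1) := by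
    have hd : ∀ t ∈ Set.Ioo (0 : ℝ) 1, HasDerivAt (fun t => D t / H t + L ^ 2 / 2 * t)
        ((D' t * H t - D t * H' t) / H t ^ 2 + L ^ 2 / 2 * 1) t := fun t ht =>
      ((hD t ht).div (hH t ht) (hIoo t ht).ne').add ((hasDerivAt_id t).const_mul _)
    refine monotoneOn_of_deriv_nonneg (convex_Icc 0 1)
      ((hDc.div hHc fun t ht => (hpos t ht).ne').add (by fun_prop)) ?_ ?_
    · rw [interior_Icc]
      exact fun t ht => (hd t ht).differentiableAt.differentiableWithinAt
    · rw [interior_Icc]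
      intro t ht
      rw [(hd t ht).deriv]
      have : -(L ^ 2 / 2) ≤ (D' t * H t - D t * H' t) / H t ^ 2 :=
        (le_div_iff₀ (pow_pos (hIoo t ht) 2)).mpr (h2 t ht)
      linarith
  have hlogc : ContinuousOn (fun t => Real.log (H t)) (Set.Icc 0 1) :=
    hHc.log fun t ht => (hpos t ht).ne'
  have hlogd : ∀ t ∈ Set.Ioo (0 : ℝ) 1, HasDerivAt (fun t => Real.log (H t)) (H' t / H t) t :=
    fun t ht => (hH t ht).log (hIoo t ht).ne'
  have hrate : ∀ t ∈ Set.Ioo (0 : ℝ) 1, |H' t / H t - 2 * (D t / H t)| ≤ 2 * L := by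
    intro t ht
    have e : H' t / H t - 2 * (D t / H t) = (H' t - 2 * D t) / H t := by ring
    rw [e, abs_div, abs_of_pos (hIoo t ht), div_le_iff₀ (hIoo t ht)]
    exact h1 t ht
  obtain ⟨c, hc⟩ : ∃ c, c = D (1 / 2) / H (1 / 2) := ⟨_, rfl⟩
  have hmid : (1 / 2 : ℝ) ∈ Set.Icc (0 : ℝ) 1 := by norm_num
  have hleft : Real.log (H (1 / 2)) - Real.log (H 0) ≤
      (2 * c + L ^ 2 / 2 + 2 * L) * (1 / 2 - 0) := by
    refine Convex.image_sub_le_mul_sub_of_deriv_le (convex_Icc (0 : ℝ) (1 / 2))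
      (f := fun t => Real.log (H t))
      (hlogc.mono (Set.Icc_subset_Icc le_rfl (by norm_num))) ?_ ?_ 0 (by norm_num) (1 / 2)
      (by norm_num) (by norm_num)
    · rw [interior_Icc]
      exact fun t ht => (hlogd t ⟨ht.1, by linarith [ht.2]⟩).differentiableAt.differentiableWithinAt
    · rw [interior_Icc]
      intro t ht
      have ht' : t ∈ Set.Ioo (0 : ℝ) 1 := ⟨ht.1, by linarith [ht.2]⟩
      rw [(hlogd t ht').deriv]
      have h3 := hN (Set.Ioo_subset_Icc_self ht') hmid ht.2.le
      have h4 := (abs_le.mp (hrate t ht')).2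
      simp only [← hc] at h3
      nlinarith [mul_nonneg (sq_nonneg L) ht.1.le]
  have hright : (2 * c - L ^ 2 / 2 - 2 * L) * (1 - 1 / 2) ≤
      Real.log (H 1) - Real.log (H (1 / 2)) := by
    refine Convex.mul_sub_le_image_sub_of_le_deriv (convex_Icc (1 / 2 : ℝ) 1)
      (f := fun t => Real.log (H t))
      (hlogc.mono (Set.Icc_subset_Icc (by norm_num) le_rfl)) ?_ ?_ (1 / 2) (by norm_num) 1
      (by norm_num) (by norm_num)
    · rw [interior_Icc]
      exact fun t ht => (hlogd t ⟨by linarith [ht.1], ht.2⟩).differentiableAt.differentiableWithinAt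
    · rw [interior_Icc]
      intro t ht
      have ht' : t ∈ Set.Ioo (0 : ℝ) 1 := ⟨by linarith [ht.1], ht.2⟩
      rw [(hlogd t ht').deriv]
      have h3 := hN hmid (Set.Ioo_subset_Icc_self ht') ht.1.le
      have h4 := (abs_le.mp (hrate t ht')).1
      simp only [← hc] at h3
      nlinarith [mul_nonneg (sq_nonneg L) (sub_nonneg.mpr ht.2.le)]
  have p0 := hpos 0 (by simp)
  have p1 := hpos 1 (by simp)
  have pm := hpos _ hmid
  rw [← Real.log_le_log_iff (by positivity) (by positivity), Real.log_mul (by positivity)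
    (by positivity), Real.log_mul p0.ne' p1.ne', Real.log_exp, Real.log_pow]
  push_cast
  linarith

/-- Weights `φ(t,n)` for which the virial term in the convexity argument is nonnegative;
`φ₁` and `φ₂` are the time derivatives of `φ`. -/
structure AdmissibleWeight (φ φ₁ φ₂ : ℝ → ℤ → ℝ) : Prop where
  deriv : ∀ t n, HasDerivAt (fun s => φ s n) (φ₁ t n) t
  deriv₁ : ∀ t n, HasDerivAt (fun s => φ₁ s n) (φ₂ t n) t
  growth : ∃ C : ℝ, ∀ t ∈ Set.Icc (0 : ℝ) 1, ∀ n : ℤ, |φ₁ t n| ≤ C * (1 + |(n : ℝ)|) ∧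
    |φ₂ t n| ≤ C * (1 + |(n : ℝ)|) ∧ |φ t (n + 1) - φ t n| ≤ C * (1 + |(n : ℝ)|)
  convex : ∀ t ∈ Set.Icc (0 : ℝ) 1, ∀ n, 0 ≤ (φ t (n + 1) - φ t n) - (φ t n - φ t (n - 1))
  virial : ∀ t ∈ Set.Icc (0 : ℝ) 1, ∀ n,
    0 ≤ φ₂ t n + 2 * Real.sinh (φ t (n + 1) - φ t n) * Real.cosh (φ t (n + 1) - φ t n)
      - 2 * Real.sinh (φ t n - φ t (n - 1)) * Real.cosh (φ t n - φ t (n - 1))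
      - 2 * |(φ₁ t (n + 1) - φ₁ t n) * Real.cosh (φ t (n + 1) - φ t n)|
      - 2 * |(φ₁ t n - φ₁ t (n - 1)) * Real.cosh (φ t n - φ t (n - 1))|
      - Real.sinh ((φ t (n + 1 + 1) - φ t (n + 1)) - (φ t (n + 1) - φ t n))
      - Real.sinh ((φ t n - φ t (n - 1)) - (φ t (n - 1) - φ t (n - 1 - 1)))

theorem tempered_of_abs_le_exp {c : ℝ → ℤ → ℝ} {C p : ℝ} (hC : 0 ≤ C) (hp : 0 ≤ p)
    (h : ∀ t ∈ Set.Icc (0 : ℝ) 1, ∀ n : ℤ, |c t n| ≤ C * Real.exp (p * |(n : ℝ)|)) (k : Fin d) :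
    Tempered fun t (j : Fin d → ℤ) => c t (j k) := by
  refine ⟨p, C, fun t ht j => (h t ht _).trans ?_⟩
  have := abs_coord_le_latL1 j k
  gcongr

theorem tempered_of_abs_le_linear {c : ℝ → ℤ → ℝ} {C : ℝ}
    (h : ∀ t ∈ Set.Icc (0 : ℝ) 1, ∀ n : ℤ, |c t n| ≤ C * (1 + |(n : ℝ)|)) (k : Fin d) :
    Tempered fun t (j : Fin d → ℤ) => c t (j k) := by
  refine tempered_of_abs_le_exp (abs_nonneg C) zero_le_one (fun t ht n => (h t ht n).trans ?_) k
  have := Real.add_one_le_exp |(n : ℝ)|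
  have h0 := abs_nonneg (n : ℝ)
  have := le_abs_self C
  rw [one_mul]
  exact mul_le_mul this (by linarith) (by linarith) (abs_nonneg C)

theorem tempered_cosh_of_abs_le_linear {c : ℝ → ℤ → ℝ} {C : ℝ}
    (h : ∀ t ∈ Set.Icc (0 : ℝ) 1, ∀ n : ℤ, |c t n| ≤ C * (1 + |(n : ℝ)|)) (k : Fin d) :
    Tempered fun t (j : Fin d → ℤ) => Real.cosh (c t (j k)) := by
  refine tempered_of_abs_le_exp (c := fun t n => Real.cosh (c t n)) (Real.exp_pos |C|).le
    (abs_nonneg C) (fun t ht n => ?_) k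
  rw [abs_of_pos (Real.cosh_pos _), ← Real.exp_add]
  have hle : Real.cosh (c t n) ≤ Real.exp |c t n| := by
    rw [← Real.cosh_abs, ← Real.cosh_add_sinh]
    linarith [Real.sinh_nonneg_iff.mpr (abs_nonneg (c t n))]
  refine hle.trans (Real.exp_le_exp.mpr ((h t ht n).trans ?_))
  have := le_abs_self C
  have h0 := abs_nonneg (n : ℝ)
  nlinarith

end LogConvexity

section WeightedConvexity

variable {d : ℕ}

theorem abs_sinh_le_cosh (x : ℝ) : |Real.sinh x| ≤ Real.cosh x :=
  abs_le.mpr ⟨by linarith [Real.sinh_lt_cosh (-x), Real.sinh_neg x, Real.cosh_neg x],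
    (Real.sinh_lt_cosh x).le⟩

theorem Tempered.of_abs_le {c c' : ℝ → (Fin d → ℤ) → ℝ} (hc : Tempered c)
    (h : ∀ t ∈ Set.Icc (0 : ℝ) 1, ∀ j, |c' t j| ≤ c t j) : Tempered c' := by
  obtain ⟨p, C, hC⟩ := hc
  exact ⟨p, C, fun t ht j => (h t ht j).trans ((le_abs_self _).trans (hC t ht j))⟩

theorem coord_add_single_self (j : Fin d → ℤ) (k : Fin d) :
    (j + (Pi.single k 1 : Fin d → ℤ)) k = j k + 1 := by simp

theorem coord_sub_single_self (j : Fin d → ℤ) (k : Fin d) :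
    (j - (Pi.single k 1 : Fin d → ℤ)) k = j k - 1 := by simp

theorem coord_add_single_of_ne (j : Fin d → ℤ) {k l : Fin d} (h : l ≠ k) :
    (j + (Pi.single l 1 : Fin d → ℤ)) k = j k := by simp [h.symm]

theorem exp_smul_deriv_eq {φ : ℤ → ℝ} (k : Fin d) (f v v' : (Fin d → ℤ) → ℂ) (p : (Fin d → ℤ) → ℝ)
    (hf : ∀ j, f j = Real.exp (φ (j k)) • v j) (j : Fin d → ℤ) :
    (Real.exp (φ (j k)) * p j) • v j + Real.exp (φ (j k)) • v' j =
      symOp k p (fun j => Real.sinh (φ (j k + 1) - φ (j k))) f j +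
      (skewHop k (fun j => Real.cosh (φ (j k + 1) - φ (j k))) f j + (transverseOp k f j +
        Real.exp (φ (j k)) • (v' j - Complex.I * discreteLap v j))) := by
  have h1 : Real.exp (φ (j k)) • discreteLap v j =
      (∑ l ∈ Finset.univ.erase k, (f (j + Pi.single l 1) + f (j - Pi.single l 1))) +
      (Real.exp (φ (j k)) • v (j + Pi.single k 1) + Real.exp (φ (j k)) • v (j - Pi.single k 1))
      - (2 * d : ℝ) • f j := by
    have h2 : discreteLap v j = (∑ l, (v (j + Pi.single l 1) + v (j - Pi.single l 1)))
        - (2 * d : ℝ) • v j := by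
      simp only [discreteLap, Finset.sum_sub_distrib, Finset.sum_const, Finset.card_univ,
        Fintype.card_fin, nsmul_eq_mul, Complex.real_smul]
      push_cast
      ring
    rw [h2, ← Finset.sum_erase_add _ _ (Finset.mem_univ k), smul_sub, smul_add, smul_add,
      Finset.smul_sum, hf j, smul_comm]
    have h3 : ∑ l ∈ Finset.univ.erase k,
        Real.exp (φ (j k)) • (v (j + Pi.single l 1) + v (j - Pi.single l 1)) =
        ∑ l ∈ Finset.univ.erase k, (f (j + Pi.single l 1) + f (j - Pi.single l 1)) := by
      refine Finset.sum_congr rfl fun l hl => ?_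
      have hlk := Finset.ne_of_mem_erase hl
      have e2 : (j - (Pi.single l 1 : Fin d → ℤ)) k = j k := by simp [hlk.symm]
      rw [hf, hf, coord_add_single_of_ne j hlk, e2, smul_add]
    rw [h3]
  have h3 : Real.exp (φ (j k)) • v (j + Pi.single k 1) =
      (Real.cosh (φ (j k + 1) - φ (j k)) - Real.sinh (φ (j k + 1) - φ (j k))) •
        f (j + Pi.single k 1) := by
    rw [Real.cosh_sub_sinh, hf, coord_add_single_self, smul_smul, ← Real.exp_add]
    congr 2; ring
  have h4 : Real.exp (φ (j k)) • v (j - Pi.single k 1) =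
      (Real.cosh (φ (j k) - φ (j k - 1)) + Real.sinh (φ (j k) - φ (j k - 1))) •
        f (j - Pi.single k 1) := by
    rw [Real.cosh_add_sinh, hf, coord_sub_single_self, smul_smul, ← Real.exp_add]
    congr 2; ring
  rw [h3, h4] at h1
  have h5 : (∑ l ∈ Finset.univ.erase k, skewHop l (fun _ => 1) f j) =
      Complex.I * ∑ l ∈ Finset.univ.erase k, (f (j + Pi.single l 1) + f (j - Pi.single l 1)) := by
    rw [Finset.mul_sum]
    exact Finset.sum_congr rfl fun l _ => by simp [skewHop]
  have h6 : Real.exp (φ (j k)) • (v' j - Complex.I * discreteLap v j) =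
      Real.exp (φ (j k)) • v' j - Complex.I * (Real.exp (φ (j k)) • discreteLap v j) := by
    rw [smul_sub, mul_smul_comm]
  have h7 : (Real.exp (φ (j k)) * p j) • v j = p j • f j := by
    rw [hf, smul_smul, mul_comm]
  rw [h7, h6, h1, transverseOp, h5]
  simp only [symOp, symHop, skewHop, coord_sub_single_self, sub_add_cancel, Complex.real_smul]
  push_cast
  ring

theorem frequency_lower_bound {H D G E K P Q L : ℝ} (hQ : 0 ≤ Q)
    (hP : P ≤ L ^ 2 * H)
    (hsq : ∀ x : ℝ, 0 ≤ E + x ^ 2 * H + P / 4 - 2 * x * D + K - x * G) (hH : 0 < H) :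
    -(L ^ 2 / 2) * H ^ 2 ≤ (Q + 2 * E + 2 * K) * H - D * (2 * D + 2 * G) := by
  have h := hsq (D / H)
  have h1 : 0 ≤ (E + (D / H) ^ 2 * H + P / 4 - 2 * (D / H) * D + K - D / H * G) * H :=
    mul_nonneg h hH.le
  have h2 : (E + (D / H) ^ 2 * H + P / 4 - 2 * (D / H) * D + K - D / H * G) * H =
      E * H + P * H / 4 - D ^ 2 + K * H - D * G := by
    field_simp; ring
  rw [h2] at h1
  have h3 := mul_le_mul_of_nonneg_right hP hH.le
  have h4 := mul_nonneg hQ hH.le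
  nlinarith

theorem inner_square_completion (s f g : ℂ) (x : ℝ) :
    0 ≤ inner ℝ s s + x ^ 2 * inner ℝ f f + 1 / 4 * inner ℝ g g - 2 * x * inner ℝ f s
      + inner ℝ s g - x * inner ℝ f g := by
  have h := real_inner_self_nonneg (x := s - x • f + (1 / 2 : ℝ) • g)
  simp only [inner_add_left, inner_add_right, inner_sub_left, inner_sub_right,
    real_inner_smul_left, real_inner_smul_right] at h
  have h1 : inner ℝ s f = inner ℝ f s := real_inner_comm _ _
  have h2 : inner ℝ g s = inner ℝ s g := real_inner_comm _ _
  have h3 : inner ℝ g f = inner ℝ f g := real_inner_comm _ _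
  rw [h1, h2, h3] at h
  linarith

theorem latInner_square_completion {s f g : ℝ → (Fin d → ℤ) → ℂ} (hs : RapidlyDecaying s)
    (hf : RapidlyDecaying f) (hg : RapidlyDecaying g) {t : ℝ} (ht : t ∈ Set.Icc (0 : ℝ) 1)
    (x : ℝ) :
    0 ≤ latInner (s t) (s t) + x ^ 2 * latInner (f t) (f t) + 1 / 4 * latInner (g t) (g t)
      - 2 * x * latInner (f t) (s t) + latInner (s t) (g t) - x * latInner (f t) (g t) := by
  have hi : ∀ {F G : ℝ → (Fin d → ℤ) → ℂ}, RapidlyDecaying F → RapidlyDecaying G →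
      HasSum (fun j => inner ℝ (F t j) (G t j)) (latInner (F t) (G t)) := fun hF hG =>
    ((hF.inner hG).summable ht).hasSum
  exact ((((((hi hs hs).add ((hi hf hf).mul_left (x ^ 2))).add ((hi hg hg).mul_left (1 / 4))).sub
    ((hi hf hs).mul_left (2 * x))).add (hi hs hg)).sub ((hi hf hg).mul_left x)).nonneg
    fun j => inner_square_completion _ _ _ _

namespace IsPerturbedSolution

variable {u u' : ℝ → (Fin d → ℤ) → ℂ} {L : ℝ}

theorem log_convexity (h : IsPerturbedSolution u u' L) {φ φ₁ φ₂ : ℝ → ℤ → ℝ}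
    (hφ : AdmissibleWeight φ φ₁ φ₂) (k : Fin d) {f : ℝ → (Fin d → ℤ) → ℂ}
    (hfu : ∀ t j, f t j = Real.exp (φ t (j k)) • u t j) (hf : RapidlyDecaying f)
    (hne : ∀ t ∈ Set.Icc (0 : ℝ) 1, ∃ j, u t j ≠ 0) :
    latInner (f (1 / 2)) (f (1 / 2)) ^ 2 ≤ Real.exp (L ^ 2 / 2 + 2 * L) *
      (latInner (f 0) (f 0) * latInner (f 1) (f 1)) := by
  obtain ⟨C, hC⟩ := hφ.growth
  obtain ⟨p, hp⟩ : ∃ p : ℝ → (Fin d → ℤ) → ℝ, p = fun t j => φ₁ t (j k) := ⟨_, rfl⟩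
  obtain ⟨q, hq⟩ : ∃ q : ℝ → (Fin d → ℤ) → ℝ, q = fun t j => φ₂ t (j k) := ⟨_, rfl⟩
  obtain ⟨a, ha⟩ : ∃ a : ℝ → (Fin d → ℤ) → ℝ,
    a = fun t j => Real.sinh (φ t (j k + 1) - φ t (j k)) := ⟨_, rfl⟩
  obtain ⟨b, hb⟩ : ∃ b : ℝ → (Fin d → ℤ) → ℝ,
    b = fun t j => Real.cosh (φ t (j k + 1) - φ t (j k)) := ⟨_, rfl⟩
  obtain ⟨τ, hτ⟩ : ∃ τ : ℝ → (Fin d → ℤ) → ℝ,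
    τ = fun t j => (p t (j + Pi.single k 1) - p t j) * b t j := ⟨_, rfl⟩
  obtain ⟨s, hs⟩ : ∃ s : ℝ → (Fin d → ℤ) → ℝ,
    s = fun t j => a t j * b t (j - Pi.single k 1) - a t (j - Pi.single k 1) * b t j := ⟨_, rfl⟩
  have hpT : Tempered p := hp ▸ tempered_of_abs_le_linear (fun t ht n => (hC t ht n).1) k
  have hqT : Tempered q := hq ▸ tempered_of_abs_le_linear (fun t ht n => (hC t ht n).2.1) k
  have hbT : Tempered b := by
    rw [hb]
    exact tempered_cosh_of_abs_le_linear (c := fun t n => φ t (n + 1) - φ t n)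
      (fun t ht n => (hC t ht n).2.2) k
  have haT : Tempered a := hbT.of_abs_le fun t _ j => by
    rw [ha, hb]; exact abs_sinh_le_cosh _
  have hτT : Tempered τ := hτ ▸ ((hpT.translate (Pi.single k 1)).sub hpT).mul hbT
  have hsT : Tempered s := hs ▸ (haT.mul (hbT.translate_sub (Pi.single k 1))).sub
    ((haT.translate_sub (Pi.single k 1)).mul hbT)
  obtain ⟨g, hg⟩ : ∃ g : ℝ → (Fin d → ℤ) → ℂ, g = fun t j =>
    Real.exp (φ t (j k)) • (u' t j - Complex.I * discreteLap (u t) j) := ⟨_, rfl⟩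
  have hgf : ∀ t ∈ Set.Icc (0 : ℝ) 1, ∀ j, ‖g t j‖ ≤ L * ‖f t j‖ := by
    intro t ht j
    rw [hg, hfu, norm_smul, norm_smul, mul_left_comm]
    exact mul_le_mul_of_nonneg_left (h.bound t ht j) (norm_nonneg _)
  have hgR : RapidlyDecaying g := (hf.smul (Tempered.const L)).of_norm_le fun t ht j => by
    rw [norm_smul, Real.norm_of_nonneg h.nonneg]; exact hgf t ht j
  obtain ⟨S, hS⟩ : ∃ S : ℝ → (Fin d → ℤ) → ℂ, S = fun t => symOp k (p t) (a t) (f t) := ⟨_, rfl⟩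
  have hSR : RapidlyDecaying S := hS ▸ hf.symOp hpT haT k
  have hskR := hf.skewHop hbT k
  have htrR := hf.transverseOp k
  obtain ⟨f', hf'⟩ : ∃ f' : ℝ → (Fin d → ℤ) → ℂ, f' = fun t j =>
    S t j + (skewHop k (b t) (f t) j + (transverseOp k (f t) j + g t j)) := ⟨_, rfl⟩
  have hf'R : RapidlyDecaying f' := hf' ▸ hSR.add (hskR.add (htrR.add hgR))
  obtain ⟨S', hS'⟩ : ∃ S' : ℝ → (Fin d → ℤ) → ℂ, S' = fun t j =>
    symOp k (q t) (τ t) (f t) j + symOp k (p t) (a t) (f' t) j := ⟨_, rfl⟩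
  have hS'R : RapidlyDecaying S' := hS' ▸ (hf.symOp hqT hτT k).add (hf'R.symOp hpT haT k)
  have hφc : ∀ n, Continuous fun t => φ t n := fun n =>
    continuous_iff_continuousAt.mpr fun t => (hφ.deriv t n).continuousAt
  have hφ₁c : ∀ n, Continuous fun t => φ₁ t n := fun n =>
    continuous_iff_continuousAt.mpr fun t => (hφ.deriv₁ t n).continuousAt
  have hfc : ∀ j, ContinuousOn (fun t => f t j) (Set.Icc 0 1) := fun j => by
    simp only [hfu]
    exact (Real.continuous_exp.comp (hφc (j k))).continuousOn.smul (h.continuousOn j)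
  have hac : ∀ j, Continuous fun t => a t j := fun j => by
    rw [ha]
    exact Real.continuous_sinh.comp ((hφc _).sub (hφc _))
  have hSc : ∀ j, ContinuousOn (fun t => S t j) (Set.Icc 0 1) := fun j => by
    rw [hS]
    refine ContinuousOn.add ?_ (continuousOn_const.mul (ContinuousOn.sub ?_ ?_))
    · rw [hp]; exact (hφ₁c _).continuousOn.smul (hfc j)
    · exact (hac _).continuousOn.smul (hfc _)
    · exact (hac _).continuousOn.smul (hfc _)
  have hfd : ∀ j, ∀ t ∈ Set.Ioo (0 : ℝ) 1, HasDerivAt (fun t => f t j) (f' t j) t := by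
    intro j t ht
    have h1 := ((hφ.deriv t (j k)).exp).smul (h.hasDerivAt ht j)
    have h2 := exp_smul_deriv_eq k (f t) (u t) (u' t) (p t) (hfu t) j
    have h3 : (fun t => f t j) = fun t => Real.exp (φ t (j k)) • u t j :=
      funext fun t => hfu t j
    rw [h3]
    refine h1.congr_deriv ?_
    rw [hf', hS, ha, hb, hg]
    simp only
    rw [← h2, hp, add_comm]
  have had : ∀ j t, HasDerivAt (fun t => a t j) (τ t j) t := by
    intro j t
    have h1 := ((hφ.deriv t (j k + 1)).sub (hφ.deriv t (j k))).sinh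
    rw [ha]
    refine h1.congr_deriv ?_
    rw [hτ, hp, hb]
    simp only [coord_add_single_self, Pi.sub_apply]
    ring
  have hSd : ∀ j, ∀ t ∈ Set.Ioo (0 : ℝ) 1, HasDerivAt (fun t => S t j) (S' t j) t := by
    intro j t ht
    have hpd : HasDerivAt (fun t => p t j) (q t j) t := by
      rw [hp, hq]; exact hφ.deriv₁ t (j k)
    have h1 := (hpd.smul (hfd j t ht)).add
      ((((had (j - Pi.single k 1) t).smul (hfd (j - Pi.single k 1) t ht)).sub
        ((had j t).smul (hfd (j + Pi.single k 1) t ht))).const_mul Complex.I)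
    rw [hS]
    refine h1.congr_deriv ?_
    rw [hS']
    simp only [symOp, symHop, Complex.real_smul]
    ring
  have hH : ∀ t ∈ Set.Ioo (0 : ℝ) 1, HasDerivAt (fun t => latInner (f t) (f t))
      (2 * latInner (f t) (S t) + 2 * latInner (f t) (g t)) t := by
    intro t ht
    have ht' := Set.Ioo_subset_Icc_self ht
    refine (hasDerivAt_latInner hf hf hf'R hf'R hfd hfd ht).congr_deriv ?_
    have e1 : latInner (f t) (f' t) = latInner (f t) (S t) +
        (latInner (f t) (skewHop k (b t) (f t)) + (latInner (f t) (transverseOp k (f t)) +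
          latInner (f t) (g t))) := by
      rw [hf', latInner_add_right hf hSR (hskR.add (htrR.add hgR)) ht',
        latInner_add_right hf hskR (htrR.add hgR) ht', latInner_add_right hf htrR hgR ht']
    have e2 := latInner_skewHop hf hf hbT k ht'
    have e3 := latInner_symOp_transverseOp_eq_zero hf (Tempered.const 1) (Tempered.const 0)
      (k := k) ht' (fun _ _ _ => rfl) (fun _ _ _ => rfl)
    have e4 : symOp k (fun _ => 1) (fun _ => 0) (f t) = f t := by
      ext j; simp [symOp, symHop]
    rw [e4] at e3
    rw [latInner_comm (skewHop _ _ _)] at e2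
    rw [latInner_comm (f' t), e1]
    linarith
  have hD : ∀ t ∈ Set.Ioo (0 : ℝ) 1, HasDerivAt (fun t => latInner (f t) (S t))
      ((latInner (f t) (symOp k (q t) (τ t) (f t)) +
        2 * latInner (symOp k (p t) (a t) (f t)) (skewHop k (b t) (f t))) +
        2 * latInner (S t) (S t) + 2 * latInner (S t) (g t)) t := by
    intro t ht
    have ht' := Set.Ioo_subset_Icc_self ht
    refine (hasDerivAt_latInner hf hSR hf'R hS'R hfd hSd ht).congr_deriv ?_
    have e0 : latInner (f t) (S' t) = latInner (f t) (symOp k (q t) (τ t) (f t)) +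
        latInner (f' t) (S t) := by
      rw [hS', latInner_add_right hf (hf.symOp hqT hτT k) (hf'R.symOp hpT haT k) ht',
        ← latInner_symOp hf hf'R hpT haT k ht', latInner_comm (f' t), hS]
    have e1 : latInner (S t) (f' t) = latInner (S t) (S t) +
        (latInner (S t) (skewHop k (b t) (f t)) + (latInner (S t) (transverseOp k (f t)) +
          latInner (S t) (g t))) := by
      rw [hf', latInner_add_right hSR hSR (hskR.add (htrR.add hgR)) ht',
        latInner_add_right hSR hskR (htrR.add hgR) ht', latInner_add_right hSR htrR hgR ht']
    have e3 : latInner (S t) (transverseOp k (f t)) = 0 := by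
      rw [hS]
      refine latInner_symOp_transverseOp_eq_zero hf hpT haT ht' ?_ ?_
      · intro l hl j; rw [hp]; simp only [coord_add_single_of_ne j hl]
      · intro l hl j; rw [ha]; simp only [coord_add_single_of_ne j hl]
    rw [e0, latInner_comm (f' t), e1, e3]
    rw [hS]
    ring
  have hpos : ∀ t ∈ Set.Icc (0 : ℝ) 1, 0 < latInner (f t) (f t) := by
    intro t ht
    obtain ⟨j, hj⟩ := hne t ht
    refine ((hf.inner hf).summable ht).tsum_pos (fun _ => real_inner_self_nonneg) j ?_
    rw [real_inner_self_eq_norm_sq, hfu, norm_smul]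
    exact pow_pos (mul_pos (norm_pos_iff.mpr (Real.exp_pos _).ne') (norm_pos_iff.mpr hj)) 2
  refine log_convexity_of_frequency (continuousOn_latInner hf hf hfc hfc)
    (continuousOn_latInner hf hSR hfc hSc) hH hD hpos ?_ ?_
  · intro t ht
    have ht' := Set.Ioo_subset_Icc_self ht
    rw [add_sub_cancel_left, abs_mul, abs_two, mul_assoc]
    refine mul_le_mul_of_nonneg_left ?_ zero_le_two
    have hs1 := ((hf.inner hgR).summable ht').norm
    refine (norm_tsum_le_tsum_norm hs1).trans ?_
    rw [latInner, ← tsum_mul_left]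
    refine Summable.tsum_le_tsum (fun j => ?_) hs1 (((hf.inner hf).summable ht').mul_left L)
    rw [real_inner_self_eq_norm_sq]
    refine (abs_real_inner_le_norm _ _).trans ?_
    have := hgf t ht' j
    nlinarith [norm_nonneg (f t j)]
  · intro t ht
    have ht' := Set.Ioo_subset_Icc_self ht
    have hsinh : ∀ j, s t j = Real.sinh
        ((φ t (j k + 1) - φ t (j k)) - (φ t (j k) - φ t (j k - 1))) := by
      intro j
      rw [hs, ha, hb]
      simp only [coord_sub_single_self, sub_add_cancel]
      generalize φ t (j k + 1) - φ t (j k) = x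
      generalize φ t (j k) - φ t (j k - 1) = y
      rw [Real.sinh_sub]
      ring
    refine frequency_lower_bound (E := latInner (S t) (S t)) (K := latInner (S t) (g t))
      (P := latInner (g t) (g t)) (virial_nonneg hf haT hbT hpT hqT hτT hsT ht' ?_ ?_ ?_ ?_) ?_ ?_
      (hpos t ht')
    · intro j; rw [hs]
    · intro j
      rw [hsinh]
      exact Real.sinh_nonneg_iff.mpr (hφ.convex t ht' (j k))
    · intro j; rw [hτ]
    · intro j
      have h1 := hφ.virial t ht' (j k)
      rw [hsinh, hsinh, hτ, hq, ha, hp, hb]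
      simp only [coord_sub_single_self, coord_add_single_self, sub_add_cancel,
        add_sub_cancel_right]
      exact h1
    · rw [latInner, latInner, ← tsum_mul_left]
      refine Summable.tsum_le_tsum (fun j => ?_) ((hgR.inner hgR).summable ht')
        (((hf.inner hf).summable ht').mul_left _)
      rw [real_inner_self_eq_norm_sq, real_inner_self_eq_norm_sq, ← mul_pow]
      exact pow_le_pow_left₀ (norm_nonneg _) (hgf t ht' j) 2
    · intro x
      have h1 := latInner_square_completion hSR hf hgR ht' x
      linarith

end IsPerturbedSolution

end WeightedConvexity

section CarlemanWeight

/-- A primitive of `(3 / 4) * arsinh` vanishing at the origin. -/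
noncomputable def weightProfile (y : ℝ) : ℝ :=
  3 / 4 * (y * Real.arsinh y - √(1 + y ^ 2) + 1)

theorem hasDerivAt_weightProfile (y : ℝ) :
    HasDerivAt weightProfile (3 / 4 * Real.arsinh y) y := by
  have h0 : 0 < 1 + y ^ 2 := by positivity
  have h1 : HasDerivAt (fun y : ℝ => 1 + y ^ 2) (2 * y) y := by
    simpa using (hasDerivAt_pow 2 y).const_add 1
  have h2 := ((((hasDerivAt_id y).mul (Real.hasDerivAt_arsinh y)).sub
    (h1.sqrt h0.ne')).add_const 1).const_mul (3 / 4)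
  refine h2.congr_deriv ?_
  have h3 : √(1 + y ^ 2) ≠ 0 := (Real.sqrt_pos.mpr h0).ne'
  simp only [id]
  field_simp
  ring

theorem abs_arsinh_le (y : ℝ) : |Real.arsinh y| ≤ |y| := by
  conv_rhs => rw [← Real.sinh_arsinh y, Real.abs_sinh]
  exact Real.self_le_sinh_iff.mpr (abs_nonneg _)

theorem exists_arsinh_sub_eq (y : ℝ) {h : ℝ} (hh : 0 < h) :
    ∃ ξ ∈ Set.Ioo y (y + h),
      Real.arsinh (y + h) - Real.arsinh y = h * (√(1 + ξ ^ 2))⁻¹ := by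
  obtain ⟨ξ, hξ, he⟩ := exists_hasDerivAt_eq_slope Real.arsinh (fun x => (√(1 + x ^ 2))⁻¹)
    (lt_add_of_pos_right y hh) Real.continuous_arsinh.continuousOn
    fun x _ => Real.hasDerivAt_arsinh x
  refine ⟨ξ, hξ, ?_⟩
  rw [add_sub_cancel_left] at he
  rw [he]
  field_simp

theorem exists_weightProfile_sub_eq (y : ℝ) {h : ℝ} (hh : 0 < h) :
    ∃ ξ ∈ Set.Ioo y (y + h),
      weightProfile (y + h) - weightProfile y = h * (3 / 4 * Real.arsinh ξ) := by
  obtain ⟨ξ, hξ, he⟩ := exists_hasDerivAt_eq_slope weightProfile (fun x => 3 / 4 * Real.arsinh x)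
    (lt_add_of_pos_right y hh) (fun x _ =>
      (hasDerivAt_weightProfile x).continuousAt.continuousWithinAt)
    fun x _ => hasDerivAt_weightProfile x
  refine ⟨ξ, hξ, ?_⟩
  rw [add_sub_cancel_left] at he
  rw [he]
  field_simp

theorem exists_weightProfile_second_difference_eq (y : ℝ) {h : ℝ} (hh : 0 < h) :
    ∃ ζ ∈ Set.Ioo (y - h) (y + h),
      (weightProfile (y + h) - weightProfile y) - (weightProfile y - weightProfile (y - h)) =
        h ^ 2 * (3 / 4 * (√(1 + ζ ^ 2))⁻¹) := by
  have hd : ∀ x, HasDerivAt (fun x => weightProfile (x + h) - weightProfile x)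
      (3 / 4 * Real.arsinh (x + h) - 3 / 4 * Real.arsinh x) x := fun x =>
    ((hasDerivAt_weightProfile (x + h)).comp_add_const x h).sub (hasDerivAt_weightProfile x)
  obtain ⟨η, hη, he⟩ := exists_hasDerivAt_eq_slope
    (fun x => weightProfile (x + h) - weightProfile x)
    (fun x => 3 / 4 * Real.arsinh (x + h) - 3 / 4 * Real.arsinh x)
    (sub_lt_self y hh) (fun x _ => (hd x).continuousAt.continuousWithinAt) fun x _ => hd x
  obtain ⟨ζ, hζ, hz⟩ := exists_arsinh_sub_eq η hh
  refine ⟨ζ, ⟨hη.1.trans hζ.1, hζ.2.trans (by linarith [hη.2])⟩, ?_⟩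
  rw [← mul_sub, hz, sub_sub_cancel, sub_add_cancel, eq_div_iff hh.ne'] at he
  rw [← he]
  ring

theorem abs_sqrt_one_add_sq_sub_le (x y : ℝ) : |√(1 + x ^ 2) - √(1 + y ^ 2)| ≤ |x - y| := by
  have hx : |x| ≤ √(1 + x ^ 2) := Real.abs_le_sqrt (by linarith)
  have hy : |y| ≤ √(1 + y ^ 2) := Real.abs_le_sqrt (by linarith)
  have hx1 : 0 < √(1 + x ^ 2) := Real.sqrt_pos.mpr (by positivity)
  have hy1 : 0 < √(1 + y ^ 2) := Real.sqrt_pos.mpr (by positivity)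
  have e : (√(1 + x ^ 2) - √(1 + y ^ 2)) * (√(1 + x ^ 2) + √(1 + y ^ 2)) = (x - y) * (x + y) := by
    have h1 := Real.sq_sqrt (show 0 ≤ 1 + x ^ 2 by positivity)
    have h2 := Real.sq_sqrt (show 0 ≤ 1 + y ^ 2 by positivity)
    linarith
  have e2 := congrArg abs e
  rw [abs_mul, abs_mul, abs_of_pos (add_pos hx1 hy1)] at e2
  have h3 : |x + y| ≤ √(1 + x ^ 2) + √(1 + y ^ 2) := (abs_add_le x y).trans (add_le_add hx hy)
  refine le_of_mul_le_mul_right ?_ (add_pos hx1 hy1)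
  rw [e2]
  exact mul_le_mul_of_nonneg_left h3 (abs_nonneg _)

theorem inv_sqrt_one_add_sq_mem {x y : ℝ} (h : |x - y| ≤ 1 / 4) :
    1 / 2 * (√(1 + y ^ 2))⁻¹ ≤ (√(1 + x ^ 2))⁻¹ ∧
      (√(1 + x ^ 2))⁻¹ ≤ 2 * (√(1 + y ^ 2))⁻¹ := by
  have h1 := abs_le.mp ((abs_sqrt_one_add_sq_sub_le x y).trans h)
  have hx : 1 ≤ √(1 + x ^ 2) := Real.one_le_sqrt.mpr (by nlinarith)
  have hy : 1 ≤ √(1 + y ^ 2) := Real.one_le_sqrt.mpr (by nlinarith)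
  generalize √(1 + x ^ 2) = X at *
  generalize √(1 + y ^ 2) = Y at *
  have hX : 0 < X := by linarith
  have hY : 0 < Y := by linarith
  constructor
  · rw [← div_eq_mul_inv, div_le_iff₀ hY, inv_mul_eq_div, le_div_iff₀ hX]
    linarith [h1.2]
  · rw [← div_eq_mul_inv, le_div_iff₀ hY, inv_mul_eq_div, div_le_iff₀ hX]
    linarith [h1.1]

theorem cosh_le_two_mul_cosh {x y : ℝ} (h : |x - y| ≤ 1 / 2) : Real.cosh x ≤ 2 * Real.cosh y := by
  have he : Real.exp (1 / 2) ≤ 2 := by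
    have h1 := Real.exp_one_lt_d9
    have h2 : Real.exp (1 / 2) ^ 2 = Real.exp 1 := by
      rw [← Real.exp_nat_mul]; norm_num
    nlinarith [Real.exp_pos (1 / 2)]
  have h1 := abs_le.mp h
  have h2 : Real.exp x ≤ 2 * Real.exp y := by
    calc Real.exp x ≤ Real.exp (1 / 2 + y) := Real.exp_le_exp.mpr (by linarith [h1.2])
      _ ≤ 2 * Real.exp y := by
        rw [Real.exp_add]; exact mul_le_mul_of_nonneg_right he (Real.exp_pos _).le
  have h3 : Real.exp (-x) ≤ 2 * Real.exp (-y) := by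
    calc Real.exp (-x) ≤ Real.exp (1 / 2 + -y) := Real.exp_le_exp.mpr (by linarith [h1.1])
      _ ≤ 2 * Real.exp (-y) := by
        rw [Real.exp_add]; exact mul_le_mul_of_nonneg_right he (Real.exp_pos _).le
  rw [Real.cosh_eq, Real.cosh_eq]
  linarith

theorem sinh_le_two_mul {x : ℝ} (h0 : 0 ≤ x) (h1 : x ≤ 1 / 2) : Real.sinh x ≤ 2 * x := by
  have h2 : Real.exp x - 1 ≤ x + x ^ 2 := by
    have := Real.abs_exp_sub_one_sub_id_le (x := x) (by rw [abs_of_nonneg h0]; linarith)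
    linarith [(abs_le.mp this).2]
  have h3 := Real.add_one_le_exp (-x)
  rw [Real.sinh_eq]
  nlinarith

theorem exp_profile_dominates (a : ℝ) :
    8 * (137 + 2 * (a * Real.cosh a)) ≤ Real.exp (120 + 3 / 2 * a) := by
  have h2 : (2 : ℝ) ≤ Real.exp 1 := by linarith [Real.add_one_le_exp (1 : ℝ)]
  have h16 : (2 : ℝ) ^ 16 ≤ Real.exp 16 := by
    calc (2 : ℝ) ^ 16 ≤ Real.exp 1 ^ 16 := pow_le_pow_left₀ (by norm_num) h2 16
      _ = Real.exp 16 := by rw [← Real.exp_nat_mul]; norm_num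
  have h120 : Real.exp 16 ≤ Real.exp 120 := Real.exp_le_exp.mpr (by norm_num)
  rcases le_total 0 a with ha | ha
  · have h3 : Real.cosh a ≤ Real.exp a := by
      rw [Real.cosh_eq]
      linarith [Real.exp_le_exp.mpr (show -a ≤ a by linarith)]
    have h4 : a ≤ 2 * Real.exp (a / 2) := by linarith [Real.add_one_le_exp (a / 2)]
    have h5 : a * Real.cosh a ≤ 2 * Real.exp (3 / 2 * a) := by
      calc a * Real.cosh a ≤ 2 * Real.exp (a / 2) * Real.exp a :=
            mul_le_mul h4 h3 (Real.cosh_pos a).le (by positivity)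
        _ = 2 * Real.exp (3 / 2 * a) := by
            rw [mul_assoc, ← Real.exp_add]; congr 2; ring
    have h6 : 1 ≤ Real.exp (3 / 2 * a) := Real.one_le_exp (by linarith)
    rw [Real.exp_add]
    nlinarith
  · have h5 : a * Real.cosh a ≤ a := by nlinarith [Real.one_le_cosh a]
    rcases le_total a (-69) with hb | hb
    · linarith [Real.exp_pos (120 + 3 / 2 * a)]
    · have := Real.exp_le_exp.mpr (show (16 : ℝ) ≤ 120 + 3 / 2 * a by linarith)
      linarith

theorem cosh_half_sum_lower_bound {x y P : ℝ} (h1 : |x - P| ≤ 1 / 4) (h2 : |y - P| ≤ 1 / 4) :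
    Real.cosh P ^ 2 - 1 / 2 ≤ Real.cosh (x + y) := by
  have h3 : |2 * P - (x + y)| ≤ 1 / 2 := by
    rw [abs_le] at *
    constructor <;> linarith [h1.1, h1.2, h2.1, h2.2]
  have h4 := cosh_le_two_mul_cosh h3
  rw [Real.cosh_two_mul, Real.sinh_sq] at h4
  linarith

theorem two_mul_sinh_mul_cosh_sub (x y : ℝ) :
    2 * Real.sinh x * Real.cosh x - 2 * Real.sinh y * Real.cosh y =
      2 * Real.sinh (x - y) * Real.cosh (x + y) := by
  rw [Real.sinh_sub, Real.cosh_add]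
  linear_combination 2 * Real.sinh x * Real.cosh x * (-(Real.cosh_sq y))
    + 2 * Real.sinh y * Real.cosh y * (Real.cosh_sq x)

theorem mul_exp_le_two_mul_cosh {R : ℝ} (hR : 0 < R) (a : ℝ) :
    R * Real.exp (60 + 3 / 4 * a) ≤ 2 * Real.cosh (60 + Real.log R + 3 / 4 * a) := by
  have h : Real.exp (60 + Real.log R + 3 / 4 * a) = R * Real.exp (60 + 3 / 4 * a) := by
    rw [add_right_comm, Real.exp_add, Real.exp_log hR, mul_comm]
  rw [← h, Real.cosh_eq]
  linarith [Real.exp_pos (-(60 + Real.log R + 3 / 4 * a))]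

theorem cosh_quadratic_bound {R : ℝ} (hR : 8 ≤ R) (a : ℝ) :
    0 ≤ Real.cosh (60 + Real.log R + 3 / 4 * a) ^ 2 - 17 / 2
      - 16 * R * Real.cosh (60 + Real.log R + 3 / 4 * a) - 2 * R ^ 2 * (a * Real.cosh a) := by
  have h1 := mul_exp_le_two_mul_cosh (by linarith : 0 < R) a
  have h2 := exp_profile_dominates a
  have h3 : Real.exp (120 + 3 / 2 * a) = Real.exp (60 + 3 / 4 * a) ^ 2 := by
    rw [← Real.exp_nat_mul]; congr 1; push_cast; ring
  rw [h3] at h2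
  have h0 := Real.exp_pos (60 + 3 / 4 * a)
  generalize Real.exp (60 + 3 / 4 * a) = E at *
  generalize Real.cosh (60 + Real.log R + 3 / 4 * a) = c at *
  generalize a * Real.cosh a = A at *
  have h4 : (R * E) ^ 2 ≤ (2 * c) ^ 2 := pow_le_pow_left₀ (by positivity) h1 2
  have h5 : R ^ 2 * (8 * (137 + 2 * A)) ≤ R ^ 2 * E ^ 2 :=
    mul_le_mul_of_nonneg_left h2 (sq_nonneg R)
  nlinarith [sq_nonneg (c - 16 * R)]

theorem virial_density_nonneg {R a v w x y p q D E : ℝ} (hR : 8 ≤ R)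
    (hv : v * (R * Real.cosh a) = 3 / 4) (hw : -(2 * R * (3 / 4 * a)) ≤ w)
    (hx : |x - (60 + Real.log R + 3 / 4 * a)| ≤ 2 * v)
    (hy : |y - (60 + Real.log R + 3 / 4 * a)| ≤ 2 * v)
    (hxy : 1 / 2 * v ≤ x - y) (hp : 0 ≤ p) (hp' : p ≤ 2 * v) (hq : 0 ≤ q) (hq' : q ≤ 2 * v)
    (hD : |D| ≤ 2 * R * v) (hE : |E| ≤ 2 * R * v) :
    0 ≤ w + 2 * Real.sinh x * Real.cosh x - 2 * Real.sinh y * Real.cosh y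
      - 2 * |D * Real.cosh x| - 2 * |E * Real.cosh y| - Real.sinh p - Real.sinh q := by
  have hZ := Real.one_le_cosh a
  have hR0 : 0 < R := by linarith
  have hv0 : 0 < v := by
    by_contra! hc
    have : v * (R * Real.cosh a) ≤ 0 :=
      mul_nonpos_of_nonpos_of_nonneg hc (by positivity)
    linarith
  have hv1 : v ≤ 1 / 8 := by
    have h8 : 8 ≤ R * Real.cosh a := by nlinarith
    nlinarith
  have hq0 := cosh_quadratic_bound hR a
  have hcx := cosh_le_two_mul_cosh (hx.trans (by linarith))
  have hcy := cosh_le_two_mul_cosh (hy.trans (by linarith))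
  have hs := cosh_half_sum_lower_bound (hx.trans (by linarith)) (hy.trans (by linarith))
  have hc1 := Real.one_le_cosh (60 + Real.log R + 3 / 4 * a)
  generalize Real.cosh (60 + Real.log R + 3 / 4 * a) = c at *
  have hsp := sinh_le_two_mul hp (by linarith)
  have hsq := sinh_le_two_mul hq (by linarith)
  have hDc : |D * Real.cosh x| ≤ 2 * R * v * (2 * c) := by
    rw [abs_mul, abs_of_pos (a := Real.cosh _) (Real.cosh_pos _)]
    exact mul_le_mul hD hcx (Real.cosh_pos x).le (by positivity)
  have hEc : |E * Real.cosh y| ≤ 2 * R * v * (2 * c) := by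
    rw [abs_mul, abs_of_pos (a := Real.cosh _) (Real.cosh_pos _)]
    exact mul_le_mul hE hcy (Real.cosh_pos y).le (by positivity)
  have hsd : 1 / 2 * v ≤ Real.sinh (x - y) :=
    hxy.trans (Real.self_le_sinh_iff.mpr (by linarith))
  have hmain : v * (c ^ 2 - 1 / 2) ≤ 2 * Real.sinh (x - y) * Real.cosh (x + y) := by
    have : 1 / 2 * v * (c ^ 2 - 1 / 2) ≤ Real.sinh (x - y) * Real.cosh (x + y) :=
      mul_le_mul hsd hs (by nlinarith) (by linarith)
    linarith
  have hkey := mul_nonneg hv0.le hq0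
  have e : v * (2 * R ^ 2 * (a * Real.cosh a)) = 2 * R * (3 / 4 * a) := by
    linear_combination 2 * R * a * hv
  have e2 := two_mul_sinh_mul_cosh_sub x y
  nlinarith

/-- The Carleman weight exponent at scale `R`. -/
noncomputable def carlemanWeight (R t : ℝ) (n : ℤ) : ℝ :=
  (60 + Real.log R) * n + R * weightProfile (n / R + t * (1 - t))

/-- The first time derivative of `carlemanWeight`. -/
noncomputable def carlemanWeight₁ (R t : ℝ) (n : ℤ) : ℝ :=
  R * (1 - 2 * t) * (3 / 4 * Real.arsinh (n / R + t * (1 - t)))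

/-- The second time derivative of `carlemanWeight`. -/
noncomputable def carlemanWeight₂ (R t : ℝ) (n : ℤ) : ℝ :=
  R * (1 - 2 * t) ^ 2 * (3 / 4 * (√(1 + (n / R + t * (1 - t)) ^ 2))⁻¹)
    - 2 * R * (3 / 4 * Real.arsinh (n / R + t * (1 - t)))

theorem hasDerivAt_parabola (c t : ℝ) :
    HasDerivAt (fun t => c + t * (1 - t)) (1 - 2 * t) t := by
  have h := ((hasDerivAt_id t).mul ((hasDerivAt_id t).const_sub 1)).const_add c
  refine h.congr_deriv ?_
  simp only [id]
  ring

theorem hasDerivAt_carlemanWeight (R t : ℝ) (n : ℤ) :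
    HasDerivAt (fun t => carlemanWeight R t n) (carlemanWeight₁ R t n) t := by
  have h := (((hasDerivAt_weightProfile (n / R + t * (1 - t))).comp t
    (hasDerivAt_parabola (n / R) t)).const_mul R).const_add ((60 + Real.log R) * n)
  refine h.congr_deriv ?_
  rw [carlemanWeight₁]
  ring

theorem hasDerivAt_carlemanWeight₁ (R t : ℝ) (n : ℤ) :
    HasDerivAt (fun t => carlemanWeight₁ R t n) (carlemanWeight₂ R t n) t := by
  have h1 : HasDerivAt (fun t : ℝ => R * (1 - 2 * t)) (R * -(2 * 1)) t :=
    (((hasDerivAt_id t).const_mul 2).const_sub 1).const_mul R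
  have h := h1.mul (((Real.hasDerivAt_arsinh (n / R + t * (1 - t))).comp t
    (hasDerivAt_parabola (n / R) t)).const_mul (3 / 4))
  refine h.congr_deriv ?_
  simp only [carlemanWeight₂, Function.comp]
  ring

theorem carlemanWeight_succ_sub (R t : ℝ) (n : ℤ) :
    carlemanWeight R t (n + 1) - carlemanWeight R t n = 60 + Real.log R +
      R * (weightProfile (n / R + t * (1 - t) + 1 / R) - weightProfile (n / R + t * (1 - t))) := by
  have : ((n + 1 : ℤ) : ℝ) / R + t * (1 - t) = n / R + t * (1 - t) + 1 / R := by
    push_cast; ring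
  rw [carlemanWeight, carlemanWeight, this]
  push_cast
  ring

theorem carlemanWeight₁_succ_sub (R t : ℝ) (n : ℤ) :
    carlemanWeight₁ R t (n + 1) - carlemanWeight₁ R t n = R * (1 - 2 * t) * (3 / 4 *
      (Real.arsinh (n / R + t * (1 - t) + 1 / R) - Real.arsinh (n / R + t * (1 - t)))) := by
  have : ((n + 1 : ℤ) : ℝ) / R + t * (1 - t) = n / R + t * (1 - t) + 1 / R := by
    push_cast; ring
  rw [carlemanWeight₁, carlemanWeight₁, this]
  ring

theorem exists_carlemanWeight_succ_sub_eq {R : ℝ} (hR : 0 < R) (t : ℝ) (n : ℤ) :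
    ∃ ξ ∈ Set.Ioo (n / R + t * (1 - t)) (n / R + t * (1 - t) + 1 / R),
      carlemanWeight R t (n + 1) - carlemanWeight R t n =
        60 + Real.log R + 3 / 4 * Real.arsinh ξ := by
  obtain ⟨ξ, hξ, he⟩ := exists_weightProfile_sub_eq (n / R + t * (1 - t)) (one_div_pos.mpr hR)
  refine ⟨ξ, hξ, ?_⟩
  rw [carlemanWeight_succ_sub, he]
  field_simp

theorem exists_carlemanWeight_second_difference_eq {R : ℝ} (hR : 0 < R) (t : ℝ) (n : ℤ) :
    ∃ ζ ∈ Set.Ioo (n / R + t * (1 - t) - 1 / R) (n / R + t * (1 - t) + 1 / R),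
      (carlemanWeight R t (n + 1) - carlemanWeight R t n) -
        (carlemanWeight R t n - carlemanWeight R t (n - 1)) =
        3 / 4 / R * (√(1 + ζ ^ 2))⁻¹ := by
  obtain ⟨ζ, hζ, he⟩ :=
    exists_weightProfile_second_difference_eq (n / R + t * (1 - t)) (one_div_pos.mpr hR)
  refine ⟨ζ, hζ, ?_⟩
  have h1 := carlemanWeight_succ_sub R t (n - 1)
  have h2 : ((n - 1 : ℤ) : ℝ) / R + t * (1 - t) = n / R + t * (1 - t) - 1 / R := by
    push_cast; ring
  rw [sub_add_cancel, h2, sub_add_cancel] at h1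
  rw [h1, carlemanWeight_succ_sub, add_sub_add_left_eq_sub, ← mul_sub, he]
  field_simp

theorem abs_arsinh_sub_le {x y : ℝ} (h : |x - y| ≤ 1 / 4) :
    |Real.arsinh x - Real.arsinh y| ≤ |x - y| * (2 * (√(1 + y ^ 2))⁻¹) := by
  rcases lt_trichotomy x y with hxy | hxy | hxy
  · obtain ⟨ξ, hξ, he⟩ := exists_arsinh_sub_eq x (sub_pos.mpr hxy)
    rw [add_sub_cancel] at he hξ
    rw [abs_sub_comm, he, abs_sub_comm x, abs_mul, abs_of_nonneg (a := (_)⁻¹) (by positivity)]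
    rw [abs_of_neg (sub_neg.mpr hxy)] at h
    refine mul_le_mul_of_nonneg_left (inv_sqrt_one_add_sq_mem ?_).2 (abs_nonneg _)
    rw [abs_le]; constructor <;> linarith [hξ.1, hξ.2]
  · simp [hxy]
  · obtain ⟨ξ, hξ, he⟩ := exists_arsinh_sub_eq y (sub_pos.mpr hxy)
    rw [add_sub_cancel] at he hξ
    rw [he, abs_mul, abs_of_nonneg (a := (_)⁻¹) (by positivity)]
    rw [abs_of_pos (sub_pos.mpr hxy)] at h
    refine mul_le_mul_of_nonneg_left (inv_sqrt_one_add_sq_mem ?_).2 (abs_nonneg _)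
    rw [abs_le]; constructor <;> linarith [hξ.1, hξ.2]

theorem carlemanWeight_convex {R : ℝ} (hR : 0 < R) (t : ℝ) (n : ℤ) :
    0 ≤ (carlemanWeight R t (n + 1) - carlemanWeight R t n) -
      (carlemanWeight R t n - carlemanWeight R t (n - 1)) := by
  obtain ⟨ζ, -, he⟩ := exists_carlemanWeight_second_difference_eq hR t n
  rw [he]
  positivity

theorem carlemanWeight_virial {R : ℝ} (hR : 8 ≤ R) {t : ℝ} (ht : t ∈ Set.Icc (0 : ℝ) 1) (n : ℤ) :
    0 ≤ carlemanWeight₂ R t n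
      + 2 * Real.sinh (carlemanWeight R t (n + 1) - carlemanWeight R t n) *
        Real.cosh (carlemanWeight R t (n + 1) - carlemanWeight R t n)
      - 2 * Real.sinh (carlemanWeight R t n - carlemanWeight R t (n - 1)) *
        Real.cosh (carlemanWeight R t n - carlemanWeight R t (n - 1))
      - 2 * |(carlemanWeight₁ R t (n + 1) - carlemanWeight₁ R t n) *
        Real.cosh (carlemanWeight R t (n + 1) - carlemanWeight R t n)|
      - 2 * |(carlemanWeight₁ R t n - carlemanWeight₁ R t (n - 1)) *
        Real.cosh (carlemanWeight R t n - carlemanWeight R t (n - 1))|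
      - Real.sinh ((carlemanWeight R t (n + 1 + 1) - carlemanWeight R t (n + 1)) -
        (carlemanWeight R t (n + 1) - carlemanWeight R t n))
      - Real.sinh ((carlemanWeight R t n - carlemanWeight R t (n - 1)) -
        (carlemanWeight R t (n - 1) - carlemanWeight R t (n - 1 - 1))) := by
  have hR0 : 0 < R := by linarith
  have hi : 1 / R ≤ 1 / 8 := one_div_le_one_div_of_le (by norm_num) hR
  have hi0 : 0 < 1 / R := one_div_pos.mpr hR0
  have hσ : |1 - 2 * t| ≤ 1 := by
    rw [abs_le]; constructor <;> linarith [ht.1, ht.2]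
  obtain ⟨ξ, hξ, hx⟩ := exists_carlemanWeight_succ_sub_eq hR0 t n
  obtain ⟨η, hη, hy⟩ := exists_carlemanWeight_succ_sub_eq hR0 t (n - 1)
  obtain ⟨ζ, hζ, hxy⟩ := exists_carlemanWeight_second_difference_eq hR0 t n
  obtain ⟨ζ₁, hζ₁, hp⟩ := exists_carlemanWeight_second_difference_eq hR0 t (n + 1)
  obtain ⟨ζ₂, hζ₂, hq⟩ := exists_carlemanWeight_second_difference_eq hR0 t (n - 1)
  have hD := carlemanWeight₁_succ_sub R t n
  have hE := carlemanWeight₁_succ_sub R t (n - 1)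
  have h1 : ((n + 1 : ℤ) : ℝ) / R + t * (1 - t) = n / R + t * (1 - t) + 1 / R := by
    push_cast; ring
  have h2 : ((n - 1 : ℤ) : ℝ) / R + t * (1 - t) = n / R + t * (1 - t) - 1 / R := by
    push_cast; ring
  rw [h1, add_sub_cancel_right] at hζ₁
  rw [h2, sub_add_cancel] at hζ₂ hη
  rw [h2, sub_add_cancel, sub_add_cancel] at hE
  rw [sub_add_cancel] at hy hq
  rw [add_sub_cancel_right] at hp
  have hw : -(2 * R * (3 / 4 * Real.arsinh (n / R + t * (1 - t)))) ≤ carlemanWeight₂ R t n := by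
    rw [carlemanWeight₂, ← zero_sub]
    gcongr
    positivity
  generalize (n : ℝ) / R + t * (1 - t) = y at *
  have hinv : 3 / 4 / R * (√(1 + y ^ 2))⁻¹ * (R * Real.cosh (Real.arsinh y)) = 3 / 4 := by
    rw [Real.cosh_arsinh]
    have : √(1 + y ^ 2) ≠ 0 := (Real.sqrt_pos.mpr (by positivity)).ne'
    field_simp
  have hN : 0 < (√(1 + y ^ 2))⁻¹ := inv_pos.mpr (Real.sqrt_pos.mpr (by positivity))
  have hslope : ∀ s, |s - y| ≤ 1 / R →
      |60 + Real.log R + 3 / 4 * Real.arsinh s - (60 + Real.log R + 3 / 4 * Real.arsinh y)| ≤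
        2 * (3 / 4 / R * (√(1 + y ^ 2))⁻¹) := by
    intro s hs
    rw [add_sub_add_left_eq_sub, ← mul_sub, abs_mul, abs_of_pos (by norm_num : (0 : ℝ) < 3 / 4)]
    calc 3 / 4 * |Real.arsinh s - Real.arsinh y|
        ≤ 3 / 4 * (1 / R * (2 * (√(1 + y ^ 2))⁻¹)) := by
          refine mul_le_mul_of_nonneg_left ?_ (by norm_num)
          exact (abs_arsinh_sub_le (hs.trans (by linarith))).trans
            (mul_le_mul_of_nonneg_right hs (by positivity))
      _ = _ := by ring
  have hupper : ∀ s, |s - y| ≤ 1 / 4 → 3 / 4 / R * (√(1 + s ^ 2))⁻¹ ≤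
      2 * (3 / 4 / R * (√(1 + y ^ 2))⁻¹) := by
    intro s hs
    rw [mul_left_comm]
    exact mul_le_mul_of_nonneg_left (inv_sqrt_one_add_sq_mem hs).2 (by positivity)
  have htime : ∀ s, |s| ≤ 1 / R * (2 * (√(1 + y ^ 2))⁻¹) → |R * (1 - 2 * t) * (3 / 4 * s)| ≤
      2 * R * (3 / 4 / R * (√(1 + y ^ 2))⁻¹) := by
    intro s hs
    rw [abs_mul, abs_mul, abs_mul, abs_of_pos hR0, abs_of_pos (by norm_num : (0 : ℝ) < 3 / 4)]
    calc R * |1 - 2 * t| * (3 / 4 * |s|)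
        ≤ R * 1 * (3 / 4 * (1 / R * (2 * (√(1 + y ^ 2))⁻¹))) := by gcongr
      _ = _ := by ring
  refine virial_density_nonneg hR hinv hw ?_ ?_ ?_ ?_ ?_ ?_ ?_ ?_ ?_
  · rw [hx]
    refine hslope ξ ?_
    rw [abs_le]; constructor <;> linarith [hξ.1, hξ.2]
  · rw [hy]
    refine hslope η ?_
    rw [abs_le]; constructor <;> linarith [hη.1, hη.2]
  · rw [hxy, mul_left_comm]
    refine mul_le_mul_of_nonneg_left (inv_sqrt_one_add_sq_mem ?_).1 (by positivity)
    rw [abs_le]; constructor <;> linarith [hζ.1, hζ.2]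
  · rw [hp]; positivity
  · rw [hp]
    refine hupper ζ₁ ?_
    rw [abs_le]; constructor <;> linarith [hζ₁.1, hζ₁.2]
  · rw [hq]; positivity
  · rw [hq]
    refine hupper ζ₂ ?_
    rw [abs_le]; constructor <;> linarith [hζ₂.1, hζ₂.2]
  · rw [hD]
    refine htime _ ?_
    have := abs_arsinh_sub_le (x := y + 1 / R) (y := y)
      (by rw [add_sub_cancel_left, abs_of_pos hi0]; linarith)
    rwa [add_sub_cancel_left, abs_of_pos hi0] at this
  · rw [hE]
    refine htime _ ?_
    have := abs_arsinh_sub_le (x := y - 1 / R) (y := y)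
      (by rw [sub_sub_cancel_left, abs_neg, abs_of_pos hi0]; linarith)
    rwa [sub_sub_cancel_left, abs_neg, abs_of_pos hi0, abs_sub_comm] at this

theorem abs_div_add_parabola_le {R : ℝ} (hR : 1 ≤ R) {t : ℝ} (ht : t ∈ Set.Icc (0 : ℝ) 1)
    (n : ℤ) : |(n : ℝ) / R + t * (1 - t)| ≤ 1 + |(n : ℝ)| := by
  have h1 : |t * (1 - t)| ≤ 1 := by
    rw [abs_of_nonneg (mul_nonneg ht.1 (by linarith [ht.2]))]
    nlinarith [ht.1, ht.2]
  have h2 : |(n : ℝ) / R| ≤ |(n : ℝ)| := by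
    rw [abs_div, abs_of_pos (by linarith : 0 < R)]
    exact div_le_self (abs_nonneg _) hR
  linarith [abs_add_le ((n : ℝ) / R) (t * (1 - t))]

theorem admissibleWeight_carlemanWeight {R : ℝ} (hR : 8 ≤ R) :
    AdmissibleWeight (carlemanWeight R) (carlemanWeight₁ R) (carlemanWeight₂ R) where
  deriv t n := hasDerivAt_carlemanWeight R t n
  deriv₁ t n := hasDerivAt_carlemanWeight₁ R t n
  growth := by
    have hR0 : 0 < R := by linarith
    have hl : 0 ≤ Real.log R := Real.log_nonneg (by linarith)
    refine ⟨3 * R + (62 + Real.log R), fun t ht n => ?_⟩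
    have hy := abs_div_add_parabola_le (by linarith : 1 ≤ R) ht n
    have ha := (abs_arsinh_le _).trans hy
    have hσ : |1 - 2 * t| ≤ 1 := by
      rw [abs_le]; constructor <;> linarith [ht.1, ht.2]
    have hn := abs_nonneg (n : ℝ)
    have hlin : 0 ≤ (62 + Real.log R) * (1 + |(n : ℝ)|) := by positivity
    have hRn : 0 ≤ R * (1 + |(n : ℝ)|) := by positivity
    have h34 : |(3 / 4 : ℝ)| = 3 / 4 := by norm_num
    refine ⟨?_, ?_, ?_⟩
    · rw [carlemanWeight₁, abs_mul, abs_mul, abs_mul, abs_of_pos hR0, h34]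
      have : R * |1 - 2 * t| * (3 / 4 * |Real.arsinh (n / R + t * (1 - t))|) ≤
          R * 1 * (3 / 4 * (1 + |(n : ℝ)|)) := by gcongr
      nlinarith
    · rw [carlemanWeight₂]
      refine (abs_sub _ _).trans ?_
      rw [abs_mul, abs_mul, abs_mul, abs_mul, abs_mul, abs_mul, abs_of_pos hR0, h34, abs_pow,
        abs_two, abs_of_nonneg (a := (_)⁻¹) (by positivity)]
      have hZ : (√(1 + ((n : ℝ) / R + t * (1 - t)) ^ 2))⁻¹ ≤ 1 :=
        inv_le_one_of_one_le₀ (Real.one_le_sqrt.mpr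
          (by nlinarith [sq_nonneg ((n : ℝ) / R + t * (1 - t))]))
      have h1 : R * |1 - 2 * t| ^ 2 * (3 / 4 * (√(1 + ((n : ℝ) / R + t * (1 - t)) ^ 2))⁻¹) ≤
          R * 1 ^ 2 * (3 / 4 * 1) := by gcongr
      have h2 : 2 * R * (3 / 4 * |Real.arsinh (n / R + t * (1 - t))|) ≤
          2 * R * (3 / 4 * (1 + |(n : ℝ)|)) := by gcongr
      nlinarith
    · obtain ⟨ξ, hξ, hx⟩ := exists_carlemanWeight_succ_sub_eq hR0 t n
      have hi : 1 / R ≤ 1 := by rw [div_le_one hR0]; linarith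
      have hξ' : |ξ| ≤ 2 + |(n : ℝ)| := by
        rw [abs_le] at hy ⊢
        constructor <;> linarith [hξ.1, hξ.2]
      rw [hx]
      refine (abs_add_le _ _).trans ?_
      rw [abs_mul, h34, abs_of_nonneg (a := 60 + _) (by positivity)]
      have := (abs_arsinh_le ξ).trans hξ'
      nlinarith
  convex t _ n := carlemanWeight_convex (by linarith) t n
  virial t ht n := carlemanWeight_virial hR ht n

end CarlemanWeight

section CarlemanWeightBounds

theorem weightProfile_le (y : ℝ) : weightProfile y ≤ 3 / 4 * (|y| * Real.log (1 + 2 * |y|)) := by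
  have h1 : 1 ≤ √(1 + y ^ 2) := Real.one_le_sqrt.mpr (by nlinarith)
  have h2 : y * Real.arsinh y ≤ |y| * |Real.arsinh y| := by
    rw [← abs_mul]; exact le_abs_self _
  have h4 : ∀ x : ℝ, 0 ≤ x → Real.arsinh x ≤ Real.log (1 + 2 * x) := fun x hx => by
    have h5 : √(1 + x ^ 2) ≤ 1 + x :=
      Real.sqrt_le_iff.mpr ⟨by linarith, by nlinarith⟩
    have h6 : 0 < √(1 + x ^ 2) := Real.sqrt_pos.mpr (by positivity)
    exact Real.log_le_log (by linarith) (by linarith)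
  have h3 : |Real.arsinh y| ≤ Real.log (1 + 2 * |y|) := by
    rcases le_total 0 y with hy | hy
    · rw [abs_of_nonneg hy, abs_of_nonneg (Real.arsinh_nonneg_iff.mpr hy)]
      exact h4 y hy
    · rw [abs_of_nonpos hy, abs_of_nonpos (Real.arsinh_nonpos_iff.mpr hy), ← Real.arsinh_neg]
      exact h4 (-y) (by linarith)
  have h7 := mul_le_mul_of_nonneg_left h3 (abs_nonneg y)
  rw [weightProfile]
  linarith

theorem weightProfile_eighth_pos : 0 < weightProfile (1 / 8) := by
  obtain ⟨ξ, hξ, he⟩ := exists_weightProfile_sub_eq 0 (h := 1 / 8) (by norm_num)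
  have h0 : weightProfile 0 = 0 := by simp [weightProfile]
  rw [zero_add, h0, sub_zero] at he
  rw [he]
  have := Real.arsinh_pos_iff.mpr hξ.1
  positivity

theorem weightProfile_mono {x y : ℝ} (hx : 0 ≤ x) (hxy : x ≤ y) :
    weightProfile x ≤ weightProfile y := by
  rcases hxy.eq_or_lt with rfl | hlt
  · exact le_rfl
  · obtain ⟨ξ, hξ, he⟩ := exists_weightProfile_sub_eq x (sub_pos.mpr hlt)
    rw [add_sub_cancel] at he
    have h1 := Real.arsinh_nonneg_iff.mpr (hx.trans hξ.1.le)
    have h2 := sub_pos.mpr hlt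
    have : 0 ≤ (y - x) * (3 / 4 * Real.arsinh ξ) := by positivity
    linarith

theorem carlemanWeight_le {R : ℝ} (hR : 1 ≤ R) {t : ℝ} (ht : t ∈ Set.Icc (0 : ℝ) 1) (n : ℤ) :
    carlemanWeight R t n ≤ 3 / 4 * (|(n : ℝ)| * Real.log (1 + |(n : ℝ)|)) +
      (62 + Real.log R + 2 * R) * (1 + |(n : ℝ)|) := by
  have hl := Real.log_nonneg hR
  have hy := abs_div_add_parabola_le hR ht n
  have hn := abs_nonneg (n : ℝ)
  have hRy : R * |(n : ℝ) / R + t * (1 - t)| ≤ |(n : ℝ)| + R := by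
    have h1 : |t * (1 - t)| ≤ 1 := by
      rw [abs_of_nonneg (mul_nonneg ht.1 (by linarith [ht.2]))]
      nlinarith [ht.1, ht.2]
    have hR0 : 0 < R := by linarith
    have h2 : R * |(n : ℝ) / R| = |(n : ℝ)| := by
      rw [abs_div, abs_of_pos hR0]; field_simp
    nlinarith [abs_add_le ((n : ℝ) / R) (t * (1 - t))]
  have hlog : Real.log (1 + 2 * |(n : ℝ) / R + t * (1 - t)|) ≤ 2 + Real.log (1 + |(n : ℝ)|) := by
    have h3 : (3 : ℝ) ≤ Real.exp 2 := by linarith [Real.add_one_le_exp (2 : ℝ)]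
    have h4 : Real.log (Real.exp 2 * (1 + |(n : ℝ)|)) = 2 + Real.log (1 + |(n : ℝ)|) := by
      rw [Real.log_mul (Real.exp_pos _).ne' (by positivity), Real.log_exp]
    rw [← h4]
    refine Real.log_le_log (by positivity) ?_
    nlinarith
  have hlog0 : 0 ≤ Real.log (1 + 2 * |(n : ℝ) / R + t * (1 - t)|) :=
    Real.log_nonneg (by linarith [abs_nonneg ((n : ℝ) / R + t * (1 - t))])
  have hlogn : Real.log (1 + |(n : ℝ)|) ≤ |(n : ℝ)| := by
    linarith [Real.log_le_sub_one_of_pos (show 0 < 1 + |(n : ℝ)| by positivity)]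
  have h5 : R * weightProfile (n / R + t * (1 - t)) ≤
      3 / 4 * ((|(n : ℝ)| + R) * (2 + Real.log (1 + |(n : ℝ)|))) := by
    calc R * weightProfile (n / R + t * (1 - t))
        ≤ R * (3 / 4 * (|(n : ℝ) / R + t * (1 - t)| *
            Real.log (1 + 2 * |(n : ℝ) / R + t * (1 - t)|))) :=
          mul_le_mul_of_nonneg_left (weightProfile_le _) (by linarith)
      _ = 3 / 4 * (R * |(n : ℝ) / R + t * (1 - t)| *
            Real.log (1 + 2 * |(n : ℝ) / R + t * (1 - t)|)) := by ring
      _ ≤ _ := mul_le_mul_of_nonneg_left (mul_le_mul hRy hlog hlog0 (by positivity)) (by norm_num)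
  have h6 : (60 + Real.log R) * (n : ℝ) ≤ (60 + Real.log R) * |(n : ℝ)| :=
    mul_le_mul_of_nonneg_left (le_abs_self _) (by positivity)
  have h7 : R * Real.log (1 + |(n : ℝ)|) ≤ R * |(n : ℝ)| :=
    mul_le_mul_of_nonneg_left hlogn (by linarith)
  rw [carlemanWeight]
  nlinarith

theorem le_carlemanWeight_half {R : ℝ} (hR : 1 ≤ R) {n : ℤ} (hn : 8 * |(n : ℝ)| ≤ R) :
    R * weightProfile (1 / 8) - (60 + Real.log R) * |(n : ℝ)| ≤ carlemanWeight R (1 / 2) n := by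
  have hl := Real.log_nonneg hR
  have h1 : (1 : ℝ) / 8 ≤ n / R + 1 / 2 * (1 - 1 / 2) := by
    have : -(1 / 8) ≤ (n : ℝ) / R := by
      rw [le_div_iff₀ (by linarith)]
      linarith [neg_abs_le (n : ℝ)]
    linarith
  have h2 := mul_le_mul_of_nonneg_left (weightProfile_mono (by norm_num) h1)
    (show 0 ≤ R by linarith)
  have h3 := mul_le_mul_of_nonneg_left (neg_abs_le (n : ℝ)) (show 0 ≤ 60 + Real.log R by positivity)
  rw [carlemanWeight]
  linarith

theorem mul_log_div_sq_le {X r : ℝ} (hX : 0 < X) (hr : 0 ≤ r) :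
    r * (Real.log X - 2 * Real.log (1 + r)) ≤ 2 * √X := by
  have hs := Real.sqrt_pos.mpr hX
  have h1 : Real.log X - 2 * Real.log (1 + r) = 2 * Real.log (√X / (1 + r)) := by
    rw [Real.log_div hs.ne' (by positivity), Real.log_sqrt hX.le]
    ring
  have h2 : Real.log (√X / (1 + r)) ≤ √X / (1 + r) := by
    linarith [Real.log_le_sub_one_of_pos (show 0 < √X / (1 + r) by positivity)]
  have h3 : r * (√X / (1 + r)) ≤ √X := by
    rw [mul_div_assoc', div_le_iff₀ (by positivity)]
    nlinarith
  rw [h1]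
  nlinarith

theorem carlemanWeight_endpoint_le {R : ℝ} (hR : 1 ≤ R) {t : ℝ} (ht : t * (1 - t) = 0) {n : ℤ}
    {μ r : ℝ} (hμ : 4 ≤ μ) (hn : |(n : ℝ)| ≤ r) :
    2 * carlemanWeight R t n ≤
      4 * √(2 * R * Real.exp 60) + 2 * μ * r * Real.log (r + 1) := by
  have hl := Real.log_nonneg hR
  have hR0 : 0 < R := by linarith
  have hr : 0 ≤ r := (abs_nonneg _).trans hn
  have hX : 0 < 2 * R * Real.exp 60 := by positivity
  have h1 := mul_log_div_sq_le hX hr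
  rw [Real.log_mul (by positivity) (Real.exp_pos _).ne', Real.log_exp,
    Real.log_mul two_ne_zero hR0.ne'] at h1
  have hlr : 0 ≤ Real.log (1 + r) := Real.log_nonneg (by linarith)
  have h2 : |(n : ℝ)| * Real.log (1 + 2 * |(n : ℝ) / R|) ≤
      r * (Real.log 2 + Real.log (1 + r)) := by
    refine mul_le_mul hn ?_ (Real.log_nonneg (by linarith [abs_nonneg ((n : ℝ) / R)])) hr
    rw [← Real.log_mul two_ne_zero (by positivity)]
    refine Real.log_le_log (by positivity) ?_
    have : |(n : ℝ) / R| ≤ |(n : ℝ)| := by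
      rw [abs_div, abs_of_pos hR0]
      exact div_le_self (abs_nonneg _) hR
    linarith
  have h3 : R * weightProfile (n / R) ≤ r * (Real.log 2 + Real.log (1 + r)) := by
    have h4 := mul_le_mul_of_nonneg_left (weightProfile_le (n / R)) hR0.le
    have h5 : R * (3 / 4 * (|(n : ℝ) / R| * Real.log (1 + 2 * |(n : ℝ) / R|))) =
        3 / 4 * (|(n : ℝ)| * Real.log (1 + 2 * |(n : ℝ) / R|)) := by
      rw [abs_div, abs_of_pos hR0]; field_simp
    have h6 : 0 ≤ r * (Real.log 2 + Real.log (1 + r)) := by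
      have := Real.log_nonneg one_le_two
      positivity
    linarith
  have h7 : (60 + Real.log R) * (n : ℝ) ≤ (60 + Real.log R) * r :=
    mul_le_mul_of_nonneg_left ((le_abs_self _).trans hn) (by positivity)
  have h8 : 4 * (r * Real.log (1 + r)) ≤ μ * (r * Real.log (1 + r)) :=
    mul_le_mul_of_nonneg_right hμ (by positivity)
  have h9 : 0 ≤ r * Real.log (1 + r) := mul_nonneg hr hlr
  rw [carlemanWeight, ht, add_zero, add_comm r 1]
  linarith

theorem exists_mul_sub_log_le (D : ℝ) :
    ∃ K : ℝ, ∀ ℓ : ℝ, 0 ≤ ℓ → ℓ * (D - 1 / 4 * Real.log (1 + ℓ)) ≤ K := by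
  refine ⟨Real.exp (4 * |D|) * |D|, fun ℓ hℓ => ?_⟩
  have hl : 0 ≤ Real.log (1 + ℓ) := Real.log_nonneg (by linarith)
  rcases le_total (4 * |D|) (Real.log (1 + ℓ)) with h | h
  · have h1 : D - 1 / 4 * Real.log (1 + ℓ) ≤ 0 := by linarith [le_abs_self D]
    exact (mul_nonpos_of_nonneg_of_nonpos hℓ h1).trans (by positivity)
  · have h1 := (Real.log_le_iff_le_exp (by linarith)).mp h
    exact mul_le_mul_of_nonneg (by linarith) (by linarith [le_abs_self D]) hℓ (abs_nonneg D)

variable {d : ℕ}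

theorem rapidlyDecaying_carlemanWeight_smul {R : ℝ} (hR : 1 ≤ R) {u : ℝ → (Fin d → ℤ) → ℂ}
    {C B : ℝ} (k : Fin d)
    (h : ∀ t ∈ Set.Icc (0 : ℝ) 1, ∀ j,
      ‖u t j‖ ≤ C * Real.exp (B * latL1 j - latL1 j * Real.log (1 + latL1 j))) :
    RapidlyDecaying fun t (j : Fin d → ℤ) => Real.exp (carlemanWeight R t (j k)) • u t j := by
  intro p
  have hl := Real.log_nonneg hR
  obtain ⟨c, hc⟩ : ∃ c, c = 62 + Real.log R + 2 * R := ⟨_, rfl⟩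
  have hc0 : 0 ≤ c := by rw [hc]; linarith
  obtain ⟨K, hK⟩ := exists_mul_sub_log_le (c + B + p)
  refine ⟨|C| * Real.exp (c + K), fun t ht j => ?_⟩
  rw [norm_smul, Real.norm_of_nonneg (Real.exp_pos _).le, mul_assoc, ← Real.exp_add]
  have h1 := carlemanWeight_le hR ht (j k)
  rw [← hc] at h1
  have hj := abs_coord_le_latL1 j k
  have h0 := abs_nonneg ((j k : ℤ) : ℝ)
  have h2 : |((j k : ℤ) : ℝ)| * Real.log (1 + |((j k : ℤ) : ℝ)|) ≤
      latL1 j * Real.log (1 + latL1 j) :=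
    mul_le_mul hj (Real.log_le_log (by linarith) (by linarith)) (Real.log_nonneg (by linarith))
      (latL1_nonneg j)
  have h3 : c * (1 + |((j k : ℤ) : ℝ)|) ≤ c * (1 + latL1 j) :=
    mul_le_mul_of_nonneg_left (by linarith) hc0
  have h4 := hK (latL1 j) (latL1_nonneg j)
  calc Real.exp (carlemanWeight R t (j k)) * ‖u t j‖
      ≤ Real.exp (carlemanWeight R t (j k)) *
        (|C| * Real.exp (B * latL1 j - latL1 j * Real.log (1 + latL1 j))) := by
        refine mul_le_mul_of_nonneg_left ((h t ht j).trans ?_) (Real.exp_pos _).le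
        exact mul_le_mul_of_nonneg_right (le_abs_self C) (Real.exp_pos _).le
    _ = |C| * Real.exp (carlemanWeight R t (j k) +
        (B * latL1 j - latL1 j * Real.log (1 + latL1 j))) := by
        rw [Real.exp_add]; ring
    _ ≤ _ := by
        refine mul_le_mul_of_nonneg_left (Real.exp_le_exp.mpr ?_) (abs_nonneg C)
        linarith

end CarlemanWeightBounds

section Uniqueness

variable {d : ℕ} {u u' : ℝ → (Fin d → ℤ) → ℂ} {L : ℝ}

theorem latInner_carlemanWeight_endpoint_le {R : ℝ} (hR : 1 ≤ R) {μ : ℝ} (hμ : 4 ≤ μ)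
    {t : ℝ} (ht : t ∈ Set.Icc (0 : ℝ) 1) (ht0 : t * (1 - t) = 0) (k : Fin d)
    (hf : RapidlyDecaying fun t (j : Fin d → ℤ) =>
      Real.exp (carlemanWeight R t (j k)) • u t j)
    (hS : Summable fun j : Fin d → ℤ =>
      Real.exp (2 * μ * latNorm j * Real.log (latNorm j + 1)) * ‖u t j‖ ^ 2) :
    latInner (fun j => Real.exp (carlemanWeight R t (j k)) • u t j)
        (fun j => Real.exp (carlemanWeight R t (j k)) • u t j) ≤
      Real.exp (4 * √(2 * R * Real.exp 60)) *
        ∑' j : Fin d → ℤ, Real.exp (2 * μ * latNorm j * Real.log (latNorm j + 1)) *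
          ‖u t j‖ ^ 2 := by
  rw [latInner, ← tsum_mul_left]
  refine Summable.tsum_le_tsum (fun j => ?_) ((hf.inner hf).summable ht) (hS.mul_left _)
  rw [real_inner_self_eq_norm_sq, norm_smul, Real.norm_of_nonneg (Real.exp_pos _).le, mul_pow,
    ← mul_assoc, ← Real.exp_add, ← Real.exp_nat_mul]
  refine mul_le_mul_of_nonneg_right (Real.exp_le_exp.mpr ?_) (sq_nonneg _)
  exact_mod_cast carlemanWeight_endpoint_le hR ht0 hμ (abs_coord_le_latNorm j k)

theorem tendsto_exp_sub_sq_zero (A a b : ℝ) {c : ℝ} (hc : 0 < c) :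
    Filter.Tendsto (fun s : ℝ => A * Real.exp (a * s + b - c * s ^ 2)) Filter.atTop
      (nhds 0) := by
  have h1 : Filter.Tendsto (fun s : ℝ => s * (a - c * s) + b) Filter.atTop Filter.atBot := by
    refine Filter.tendsto_atBot_add_const_right _ _ ?_
    refine Filter.tendsto_id.atTop_mul_atBot₀ ?_
    have h2 : Filter.Tendsto (fun s : ℝ => a + -(c * s)) Filter.atTop Filter.atBot :=
      Filter.tendsto_atBot_add_const_left _ _
        (Filter.tendsto_neg_atTop_atBot.comp (Filter.tendsto_id.const_mul_atTop hc))
    simpa only [sub_eq_add_neg] using h2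
  have h3 := (Real.tendsto_exp_atBot.comp h1).const_mul A
  rw [mul_zero] at h3
  refine h3.congr fun s => ?_
  simp only [Function.comp]
  congr 2
  ring

theorem exp_sq_mul_sq {x y : ℝ} : ((Real.exp x * y) ^ 2) ^ 2 = Real.exp (4 * x) * y ^ 4 := by
  rw [← pow_mul, mul_pow, ← Real.exp_nat_mul]
  norm_num

theorem IsPerturbedSolution.eq_zero_at_half (h : IsPerturbedSolution u u' L) (k : Fin d)
    (hu : ∀ t ∈ Set.Icc (0 : ℝ) 1, Summable fun j => ‖u t j‖ ^ 2) {μ : ℝ} (hμ : 4 ≤ μ)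
    (hμd : 2 * d ≤ μ)
    (h0 : Summable fun j : Fin d → ℤ =>
      Real.exp (2 * μ * latNorm j * Real.log (latNorm j + 1)) * ‖u 0 j‖ ^ 2)
    (h1 : Summable fun j : Fin d → ℤ =>
      Real.exp (2 * μ * latNorm j * Real.log (latNorm j + 1)) * ‖u 1 j‖ ^ 2)
    (hne : ∀ t ∈ Set.Icc (0 : ℝ) 1, ∃ j, u t j ≠ 0) (j : Fin d → ℤ) : u (1 / 2) j = 0 := by
  obtain ⟨C, B, -, hdecay⟩ := h.exists_decay hu hμd h0
  obtain ⟨S₀, hS₀⟩ : ∃ S, S = ∑' j : Fin d → ℤ,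
    Real.exp (2 * μ * latNorm j * Real.log (latNorm j + 1)) * ‖u 0 j‖ ^ 2 := ⟨_, rfl⟩
  obtain ⟨S₁, hS₁⟩ : ∃ S, S = ∑' j : Fin d → ℤ,
    Real.exp (2 * μ * latNorm j * Real.log (latNorm j + 1)) * ‖u 1 j‖ ^ 2 := ⟨_, rfl⟩
  obtain ⟨N, hN⟩ : ∃ N, N = |((j k : ℤ) : ℝ)| := ⟨_, rfl⟩
  have hN0 : 0 ≤ N := hN ▸ abs_nonneg _
  have hS₀0 : 0 ≤ S₀ := hS₀ ▸ tsum_nonneg fun j => by positivity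
  have key : ∀ R : ℝ, 8 ≤ R → 8 * N ≤ R → ‖u (1 / 2) j‖ ^ 4 ≤
      Real.exp (L ^ 2 / 2 + 2 * L) * (S₀ * S₁) * Real.exp (8 * √(2 * R * Real.exp 60) +
        4 * (60 + Real.log R) * N - 4 * (R * weightProfile (1 / 8))) := by
    intro R hR hRN
    have hR1 : 1 ≤ R := by linarith
    obtain ⟨f, hf⟩ : ∃ f : ℝ → (Fin d → ℤ) → ℂ,
      f = fun t j => Real.exp (carlemanWeight R t (j k)) • u t j := ⟨_, rfl⟩
    have hfR : RapidlyDecaying f := hf ▸ rapidlyDecaying_carlemanWeight_smul hR1 k hdecay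
    have hconv := h.log_convexity (admissibleWeight_carlemanWeight hR) k
      (fun t j => congrFun (congrFun hf t) j) hfR hne
    have e0 := latInner_carlemanWeight_endpoint_le hR1 hμ (t := 0) (by simp) (by simp) k
      (hf ▸ hfR) h0
    have e1 := latInner_carlemanWeight_endpoint_le hR1 hμ (t := 1) (by simp) (by simp) k
      (hf ▸ hfR) h1
    rw [← hS₀] at e0
    rw [← hS₁] at e1
    have f0 : latInner (f 0) (f 0) ≤ Real.exp (4 * √(2 * R * Real.exp 60)) * S₀ := by
      rw [hf]; exact e0
    have f1 : latInner (f 1) (f 1) ≤ Real.exp (4 * √(2 * R * Real.exp 60)) * S₁ := by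
      rw [hf]; exact e1
    have hpos1 : 0 ≤ latInner (f 1) (f 1) := tsum_nonneg fun _ => real_inner_self_nonneg
    have hhalf : (Real.exp (carlemanWeight R (1 / 2) (j k)) * ‖u (1 / 2) j‖) ^ 2 ≤
        latInner (f (1 / 2)) (f (1 / 2)) := by
      have := ((hfR.inner hfR).summable (t := 1 / 2) ⟨by norm_num, by norm_num⟩).le_tsum j
        fun _ _ => real_inner_self_nonneg
      rw [real_inner_self_eq_norm_sq] at this
      refine le_trans (le_of_eq ?_) this
      rw [hf, norm_smul, Real.norm_of_nonneg (Real.exp_pos _).le]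
    have hφ := le_carlemanWeight_half hR1 (n := j k) (by rw [← hN]; exact hRN)
    rw [← hN] at hφ
    obtain ⟨φ, hφ'⟩ : ∃ φ, φ = carlemanWeight R (1 / 2) (j k) := ⟨_, rfl⟩
    rw [← hφ'] at hφ hhalf
    have hchain : Real.exp (4 * φ) * ‖u (1 / 2) j‖ ^ 4 ≤ Real.exp (L ^ 2 / 2 + 2 * L) *
        (S₀ * S₁) * Real.exp (8 * √(2 * R * Real.exp 60)) := by
      calc Real.exp (4 * φ) * ‖u (1 / 2) j‖ ^ 4 = ((Real.exp φ * ‖u (1 / 2) j‖) ^ 2) ^ 2 :=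
            exp_sq_mul_sq.symm
        _ ≤ latInner (f (1 / 2)) (f (1 / 2)) ^ 2 := pow_le_pow_left₀ (sq_nonneg _) hhalf 2
        _ ≤ _ := hconv
        _ ≤ Real.exp (L ^ 2 / 2 + 2 * L) * (Real.exp (4 * √(2 * R * Real.exp 60)) * S₀ *
              (Real.exp (4 * √(2 * R * Real.exp 60)) * S₁)) :=
            mul_le_mul_of_nonneg_left (mul_le_mul f0 f1 hpos1 (by positivity))
              (Real.exp_pos _).le
        _ = Real.exp (L ^ 2 / 2 + 2 * L) * (S₀ * S₁) * (Real.exp (4 * √(2 * R * Real.exp 60)) *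
              Real.exp (4 * √(2 * R * Real.exp 60))) := by ring
        _ = _ := by rw [← Real.exp_add]; ring_nf
    have hS₁0 : 0 ≤ S₁ := hS₁ ▸ tsum_nonneg fun j => by positivity
    calc ‖u (1 / 2) j‖ ^ 4 = Real.exp (-(4 * φ)) * (Real.exp (4 * φ) * ‖u (1 / 2) j‖ ^ 4) := by
          rw [← mul_assoc, ← Real.exp_add, neg_add_cancel, Real.exp_zero, one_mul]
      _ ≤ Real.exp (-(4 * φ)) * (Real.exp (L ^ 2 / 2 + 2 * L) *
            (S₀ * S₁) * Real.exp (8 * √(2 * R * Real.exp 60))) :=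
          mul_le_mul_of_nonneg_left hchain (Real.exp_pos _).le
      _ = Real.exp (L ^ 2 / 2 + 2 * L) * (S₀ * S₁) *
            Real.exp (8 * √(2 * R * Real.exp 60) - 4 * φ) := by
          rw [sub_eq_add_neg, Real.exp_add (8 * √(2 * R * Real.exp 60))]
          ring
      _ ≤ _ := by
          refine mul_le_mul_of_nonneg_left (Real.exp_le_exp.mpr ?_) (by positivity)
          linarith
  have hS₁0 : 0 ≤ S₁ := hS₁ ▸ tsum_nonneg fun j => by positivity
  have hlim := tendsto_exp_sub_sq_zero (Real.exp (L ^ 2 / 2 + 2 * L) * (S₀ * S₁))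
    (8 * √(2 * Real.exp 60) + 8 * N) (240 * N)
    (mul_pos (by norm_num : (0 : ℝ) < 4) weightProfile_eighth_pos)
  have hle : ‖u (1 / 2) j‖ ^ 4 ≤ 0 := by
    refine ge_of_tendsto hlim ?_
    filter_upwards [Filter.eventually_ge_atTop (8 + 8 * N)] with s hs
    have hs0 : 0 < s := by linarith
    refine (key (s ^ 2) (by nlinarith) (by nlinarith)).trans ?_
    refine mul_le_mul_of_nonneg_left (Real.exp_le_exp.mpr ?_) (by positivity)
    have hsq : √(2 * s ^ 2 * Real.exp 60) = √(2 * Real.exp 60) * s := by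
      rw [mul_right_comm, Real.sqrt_mul (by positivity), Real.sqrt_sq hs0.le]
    have hlog : Real.log (s ^ 2) ≤ 2 * s := by
      rw [Real.log_pow]
      push_cast
      linarith [Real.log_le_sub_one_of_pos hs0]
    have := mul_le_mul_of_nonneg_right hlog hN0
    rw [hsq]
    linarith
  have h4 : ‖u (1 / 2) j‖ ^ 4 = 0 := le_antisymm hle (by positivity)
  simpa using h4

end Uniqueness

/-- **Uniqueness for discrete Schrödinger evolutions.**
If `u ∈ C¹([0,1], ℓ²(ℤ^d))` satisfies `|i∂_t u_j + Δ_d u_j| ≤ |V_j u_j|` with a bounded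
potential `V`, then there exists `μ₀ = μ₀(d)` such that if for some `μ > μ₀`
`Σ_j e^{2μ|j| log(|j|+1)} (|u_j(0)|² + |u_j(1)|²) < ∞`, then `u ≡ 0`. -/
theorem uniqueness_discrete_schrodinger (d : ℕ) (hd : 1 ≤ d) :
    ∃ μ₀ : ℝ, 0 < μ₀ ∧
      ∀ (u u' V : ℝ → (Fin d → ℤ) → ℂ) (L : ℝ),
        -- `u ∈ C¹([0,1], ℓ²(ℤ^d))`, with time derivative `u'`
        (∀ j, ∀ t ∈ Set.Icc (0 : ℝ) 1,
          HasDerivWithinAt (fun s => u s j) (u' t j) (Set.Icc (0 : ℝ) 1) t) →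
        (∀ j, ContinuousOn (fun t => u' t j) (Set.Icc (0 : ℝ) 1)) →
        (∀ t ∈ Set.Icc (0 : ℝ) 1, Summable fun j => ‖u t j‖ ^ 2) →
        -- the differential inequality `|i ∂_t u_j + Δ_d u_j| ≤ |V_j u_j|`
        (∀ t ∈ Set.Icc (0 : ℝ) 1, ∀ j,
          ‖Complex.I * u' t j + discreteLap (u t) j‖ ≤ ‖V t j * u t j‖) →
        -- `V` is a bounded potential
        (∀ t ∈ Set.Icc (0 : ℝ) 1, ∀ j, ‖V t j‖ ≤ L) →
        ∀ μ : ℝ, μ₀ < μ →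
          Summable (fun j : Fin d → ℤ =>
            Real.exp (2 * μ * latNorm j * Real.log (latNorm j + 1)) *
              (‖u 0 j‖ ^ 2 + ‖u 1 j‖ ^ 2)) →
          ∀ t ∈ Set.Icc (0 : ℝ) 1, ∀ j, u t j = 0 := by
  have hd' : (1 : ℝ) ≤ d := by exact_mod_cast hd
  refine ⟨4 * d, by linarith, fun u u' V L hderiv _ hu hineq hV μ hμ hsum => ?_⟩
  have hsol : IsPerturbedSolution u u' L := by
    refine ⟨(norm_nonneg _).trans (hV 0 (by simp) 0), hderiv, fun t ht j => ?_⟩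
    have e : u' t j - Complex.I * discreteLap (u t) j =
        -Complex.I * (Complex.I * u' t j + discreteLap (u t) j) := by
      linear_combination u' t j * Complex.I_mul_I
    rw [e, norm_mul, norm_neg, Complex.norm_I, one_mul]
    refine (hineq t ht j).trans ?_
    rw [norm_mul]
    exact mul_le_mul_of_nonneg_right (hV t ht j) (norm_nonneg _)
  have h0 : Summable fun j : Fin d → ℤ =>
      Real.exp (2 * μ * latNorm j * Real.log (latNorm j + 1)) * ‖u 0 j‖ ^ 2 :=
    hsum.of_nonneg_of_le (fun j => by positivity) fun j =>
      mul_le_mul_of_nonneg_left (le_add_of_nonneg_right (sq_nonneg _)) (Real.exp_pos _).le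
  have h1 : Summable fun j : Fin d → ℤ =>
      Real.exp (2 * μ * latNorm j * Real.log (latNorm j + 1)) * ‖u 1 j‖ ^ 2 :=
    hsum.of_nonneg_of_le (fun j => by positivity) fun j =>
      mul_le_mul_of_nonneg_left (le_add_of_nonneg_left (sq_nonneg _)) (Real.exp_pos _).le
  intro t ht j
  by_cases hne : ∀ t ∈ Set.Icc (0 : ℝ) 1, ∃ j, u t j ≠ 0
  · exact hsol.eq_zero_of_eq_zero hu (s := 1 / 2) ⟨by norm_num, by norm_num⟩ ht
      (hsol.eq_zero_at_half ⟨0, hd⟩ hu (by linarith) (by linarith) h0 h1 hne) j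
  · push Not at hne
    obtain ⟨s, hs, hzero⟩ := hne
    exact hsol.eq_zero_of_eq_zero hu hs ht hzero j
end

section
/- Let d ≥ 1, R > 0, α ∈ ℝ, and let φ : [0,1] → ℝ be smooth. For g ∈ C₀¹([0,1], ℓ²(ℤ^d)) set f_j(t) = e^{α|j/R + φ(t)e₁|²} g_j(t). Then e^{α|j/R + φ(t)e₁|²} (i∂_t + Δ_d) g_j = S f_j + A f_j, where S f_j = i∂_t f_j − 2d f_j + Σ_{k=1}^d cosh((2α/R)((j_k + 1/2)/R + φ δ_{1k})) f_{j+e_k} + Σ_{k=1}^d cosh((2α/R)((j_k − 1/2)/R + φ δ_{1k})) f_{j−e_k}, and A f_j = −2iα (j₁/R + φ) φ' f_j − Σ_{k=1}^d sinh((2α/R)((j_k + 1/2)/R + φ δ_{1k})) f_{j+e_k} + Σ_{k=1}^d sinh((2α/R)((j_k − 1/2)/R + φ δ_{1k})) f_{j−e_k}. Moreover, for each fixed t, S is symmetric and A is skew-symmetric as operators on ℓ²(ℤ^d). -/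
/-- The Carleman weight exponent `|j/R + p e₁|²`, where `j ∈ ℤ^d` is viewed as a point
of `ℝ^d` and `e₁` is the first standard basis vector. -/
noncomputable def wgt {d : ℕ} (R p : ℝ) (j : Fin d → ℤ) : ℝ :=
  ∑ k, ((j k : ℝ) / R + if (k : ℕ) = 0 then p else 0) ^ 2

/-- The symmetric part `S` of the conjugated operator (dimension `d+1`):
`S F_j = i ∂_t F_j - 2(d+1) F_j + Σ_k cosh((2α/R)((j_k+1/2)/R + φ δ_{1k})) F_{j+e_k}
 + Σ_k cosh((2α/R)((j_k-1/2)/R + φ δ_{1k})) F_{j-e_k}`,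
where `F'` denotes the time derivative of `F`. -/
noncomputable def opS {d : ℕ} (α R : ℝ) (φ : ℝ → ℝ)
    (F F' : ℝ → (Fin (d + 1) → ℤ) → ℂ) (t : ℝ) (j : Fin (d + 1) → ℤ) : ℂ :=
  Complex.I * F' t j - 2 * ((d : ℂ) + 1) * F t j +
    (∑ k, (Real.cosh (2 * α / R * (((j k : ℝ) + 1 / 2) / R +
        if (k : ℕ) = 0 then φ t else 0)) : ℂ) * F t (j + Pi.single k 1)) +
    ∑ k, (Real.cosh (2 * α / R * (((j k : ℝ) - 1 / 2) / R +
        if (k : ℕ) = 0 then φ t else 0)) : ℂ) * F t (j - Pi.single k 1)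

/-- The skew-symmetric part `A` of the conjugated operator (dimension `d+1`):
`A F_j = -2iα(j₁/R + φ)φ' F_j - Σ_k sinh((2α/R)((j_k+1/2)/R + φ δ_{1k})) F_{j+e_k}
 + Σ_k sinh((2α/R)((j_k-1/2)/R + φ δ_{1k})) F_{j-e_k}`. -/
noncomputable def opA {d : ℕ} (α R : ℝ) (φ : ℝ → ℝ)
    (F : ℝ → (Fin (d + 1) → ℤ) → ℂ) (t : ℝ) (j : Fin (d + 1) → ℤ) : ℂ :=
  -2 * Complex.I * α * (((j 0 : ℝ) / R + φ t) * deriv φ t) * F t j -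
    (∑ k, (Real.sinh (2 * α / R * (((j k : ℝ) + 1 / 2) / R +
        if (k : ℕ) = 0 then φ t else 0)) : ℂ) * F t (j + Pi.single k 1)) +
    ∑ k, (Real.sinh (2 * α / R * (((j k : ℝ) - 1 / 2) / R +
        if (k : ℕ) = 0 then φ t else 0)) : ℂ) * F t (j - Pi.single k 1)

/-- On finitely supported functions, a nearest-neighbour operator
`T h j = D j h j + Σ_k p_k(j) h (j+e_k) + Σ_k q_k(j) h (j-e_k)` is symmetric (`ε = 1`) or
skew-symmetric (`ε = -1`) as soon as its coefficients are. -/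
theorem tsum_nearest_neighbour_mul_conj {n : ℕ} (ε : ℂ) (D : (Fin n → ℤ) → ℂ)
    (p q : Fin n → (Fin n → ℤ) → ℂ)
    (hD : ∀ j, D j = ε * (starRingEnd ℂ) (D j))
    (hp : ∀ k j, p k j = ε * (starRingEnd ℂ) (q k (j + Pi.single k 1)))
    (hq : ∀ k j, q k j = ε * (starRingEnd ℂ) (p k (j - Pi.single k 1)))
    (h w : (Fin n → ℤ) → ℂ) (hh : (Function.support h).Finite)
    (hw : (Function.support w).Finite) :
    ∑' j, (D j * h j + ∑ k, p k j * h (j + Pi.single k 1) +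
        ∑ k, q k j * h (j - Pi.single k 1)) * (starRingEnd ℂ) (w j) =
      ε * ∑' j, h j * (starRingEnd ℂ) (D j * w j + ∑ k, p k j * w (j + Pi.single k 1) +
        ∑ k, q k j * w (j - Pi.single k 1)) := by
  have summable_left (a b : (Fin n → ℤ) → ℂ) :
      Summable fun j => a j * b j * (starRingEnd ℂ) (w j) :=
    summable_of_hasFiniteSupport (hw.subset fun j hj => by
      contrapose! hj
      simp [Function.notMem_support.mp hj])
  have summable_right (a b : (Fin n → ℤ) → ℂ) :
      Summable fun j => h j * (ε * (starRingEnd ℂ) (a j * b j)) :=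
    summable_of_hasFiniteSupport (hh.subset fun j hj => by
      contrapose! hj
      simp [Function.notMem_support.mp hj])
  have forward (k : Fin n) :
      ∑' j, p k j * h (j + Pi.single k 1) * (starRingEnd ℂ) (w j) =
        ∑' j, h j * (ε * (starRingEnd ℂ) (q k j * w (j - Pi.single k 1))) := by
    refine Eq.trans (tsum_congr fun j => ?_) ((Equiv.addRight (Pi.single k (1 : ℤ))).tsum_eq
      (fun j => h j * (ε * (starRingEnd ℂ) (q k j * w (j - Pi.single k 1)))))
    simp only [Equiv.coe_addRight, add_sub_cancel_right, map_mul]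
    rw [hp k j]
    ring
  have backward (k : Fin n) :
      ∑' j, q k j * h (j - Pi.single k 1) * (starRingEnd ℂ) (w j) =
        ∑' j, h j * (ε * (starRingEnd ℂ) (p k j * w (j + Pi.single k 1))) := by
    refine Eq.trans (tsum_congr fun j => ?_) ((Equiv.subRight (Pi.single k (1 : ℤ))).tsum_eq
      (fun j => h j * (ε * (starRingEnd ℂ) (p k j * w (j + Pi.single k 1)))))
    simp only [Equiv.subRight_apply, sub_add_cancel, map_mul]
    rw [hq k j]
    ring
  have diagonal : ∑' j, D j * h j * (starRingEnd ℂ) (w j) =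
      ∑' j, h j * (ε * (starRingEnd ℂ) (D j * w j)) := by
    refine tsum_congr fun j => ?_
    rw [map_mul]
    linear_combination h j * (starRingEnd ℂ) (w j) * hD j
  rw [← tsum_mul_left]
  simp only [add_mul, Finset.sum_mul]
  rw [Summable.tsum_add ((summable_left _ _).add (summable_sum fun k _ => summable_left _ _))
      (summable_sum fun k _ => summable_left _ _),
    Summable.tsum_add (summable_left _ _) (summable_sum fun k _ => summable_left _ _),
    Summable.tsum_finsetSum fun k _ => summable_left _ _,
    Summable.tsum_finsetSum fun k _ => summable_left _ _, diagonal,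
    Finset.sum_congr rfl fun k _ => forward k, Finset.sum_congr rfl fun k _ => backward k,
    ← Summable.tsum_finsetSum fun k _ => summable_right _ _,
    ← Summable.tsum_finsetSum fun k _ => summable_right _ _,
    ← Summable.tsum_add (summable_right _ _) (summable_sum fun k _ => summable_right _ _),
    ← Summable.tsum_add ((summable_right _ _).add (summable_sum fun k _ => summable_right _ _))
      (summable_sum fun k _ => summable_right _ _)]
  refine tsum_congr fun j => ?_
  simp only [map_add, map_sum, mul_add, Finset.mul_sum, mul_left_comm ε]
  ring

theorem wgt_add_single {d : ℕ} {R : ℝ} (hR : R ≠ 0) (p : ℝ) (j : Fin d → ℤ) (k : Fin d) :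
    wgt R p (j + Pi.single k 1) =
      wgt R p j + 2 / R * (((j k : ℝ) + 1 / 2) / R + if (k : ℕ) = 0 then p else 0) := by
  unfold wgt
  rw [← Finset.add_sum_erase _ _ (Finset.mem_univ k),
    ← Finset.add_sum_erase Finset.univ
      (fun i => ((j i : ℝ) / R + if (i : ℕ) = 0 then p else 0) ^ 2) (Finset.mem_univ k),
    Finset.sum_congr rfl fun i hi => by
      rw [Pi.add_apply, Pi.single_eq_of_ne (Finset.ne_of_mem_erase hi), add_zero]]
  simp only [Pi.add_apply, Pi.single_eq_same, Int.cast_add, Int.cast_one]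
  field_simp
  ring

theorem wgt_sub_single {d : ℕ} {R : ℝ} (hR : R ≠ 0) (p : ℝ) (j : Fin d → ℤ) (k : Fin d) :
    wgt R p (j - Pi.single k 1) =
      wgt R p j - 2 / R * (((j k : ℝ) - 1 / 2) / R + if (k : ℕ) = 0 then p else 0) := by
  have h := wgt_add_single hR p (j - Pi.single k 1) k
  simp only [sub_add_cancel, Pi.sub_apply, Pi.single_eq_same, Int.cast_sub, Int.cast_one] at h
  rw [h]
  ring

theorem hasDerivAt_wgt {d : ℕ} {R : ℝ} {φ : ℝ → ℝ} {φ' t : ℝ} (hφ : HasDerivAt φ φ' t)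
    (j : Fin (d + 1) → ℤ) :
    HasDerivAt (fun s => wgt R (φ s) j) (2 * (((j 0 : ℝ) / R + φ t) * φ')) t := by
  unfold wgt
  simp only [Fin.sum_univ_succ, Fin.val_zero, if_true, Fin.val_succ, Nat.succ_ne_zero,
    if_false]
  refine (((hφ.const_add ((j 0 : ℝ) / R)).pow 2).add_const _).congr_deriv ?_
  ring

theorem exp_wgt_mul_forward {d : ℕ} {R : ℝ} (hR : R ≠ 0) (α p : ℝ) (j : Fin d → ℤ)
    (k : Fin d) :
    Real.exp (α * wgt R p j) =
      (Real.cosh (2 * α / R * (((j k : ℝ) + 1 / 2) / R + if (k : ℕ) = 0 then p else 0)) -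
        Real.sinh (2 * α / R * (((j k : ℝ) + 1 / 2) / R + if (k : ℕ) = 0 then p else 0))) *
      Real.exp (α * wgt R p (j + Pi.single k 1)) := by
  rw [Real.cosh_sub_sinh, ← Real.exp_add, wgt_add_single hR]
  congr 1
  ring

theorem exp_wgt_mul_backward {d : ℕ} {R : ℝ} (hR : R ≠ 0) (α p : ℝ) (j : Fin d → ℤ)
    (k : Fin d) :
    Real.exp (α * wgt R p j) =
      (Real.cosh (2 * α / R * (((j k : ℝ) - 1 / 2) / R + if (k : ℕ) = 0 then p else 0)) +
        Real.sinh (2 * α / R * (((j k : ℝ) - 1 / 2) / R + if (k : ℕ) = 0 then p else 0))) *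
      Real.exp (α * wgt R p (j - Pi.single k 1)) := by
  rw [Real.cosh_add_sinh, ← Real.exp_add, wgt_sub_single hR]
  congr 1
  ring

/-- Conjugating the discrete Laplacian by the Carleman weight. -/
theorem exp_wgt_mul_discreteLap {d : ℕ} {R : ℝ} (hR : R ≠ 0) (α p : ℝ)
    (u : (Fin d → ℤ) → ℂ) (j : Fin d → ℤ) :
    (Real.exp (α * wgt R p j) : ℂ) * discreteLap u j =
      ∑ k, (((Real.cosh (2 * α / R * (((j k : ℝ) + 1 / 2) / R +
              if (k : ℕ) = 0 then p else 0)) : ℂ) -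
            Real.sinh (2 * α / R * (((j k : ℝ) + 1 / 2) / R +
              if (k : ℕ) = 0 then p else 0))) *
          (Real.exp (α * wgt R p (j + Pi.single k 1)) * u (j + Pi.single k 1)) +
        ((Real.cosh (2 * α / R * (((j k : ℝ) - 1 / 2) / R +
              if (k : ℕ) = 0 then p else 0)) : ℂ) +
            Real.sinh (2 * α / R * (((j k : ℝ) - 1 / 2) / R +
              if (k : ℕ) = 0 then p else 0))) *
          (Real.exp (α * wgt R p (j - Pi.single k 1)) * u (j - Pi.single k 1)) -
        2 * (Real.exp (α * wgt R p j) * u j)) := by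
  unfold discreteLap
  rw [Finset.mul_sum]
  refine Finset.sum_congr rfl fun k _ => ?_
  have hf := congrArg (fun x : ℝ => (x : ℂ)) (exp_wgt_mul_forward hR α p j k)
  have hb := congrArg (fun x : ℝ => (x : ℂ)) (exp_wgt_mul_backward hR α p j k)
  simp only [Complex.ofReal_mul, Complex.ofReal_add, Complex.ofReal_sub] at hf hb
  linear_combination u (j + Pi.single k 1) * hf + u (j - Pi.single k 1) * hb

/-- **Decomposition of the conjugated operator into symmetric and skew-symmetric parts.**
With `f_j(t) = e^{α|j/R + φ(t)e₁|²} g_j(t)` one has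
`e^{α|j/R + φ(t)e₁|²} (i∂_t + Δ_d) g_j = S f_j + A f_j`; moreover, for each fixed `t`,
(the spatial part of) `S` is symmetric and `A` is skew-symmetric on `ℓ²(ℤ^d)`. -/
theorem conjugated_operator_decomposition (d : ℕ) (R α : ℝ) (hR : 0 < R)
    (φ : ℝ → ℝ) (hφ : ContDiff ℝ (⊤ : ℕ∞) φ)
    (g g' f f' : ℝ → (Fin (d + 1) → ℤ) → ℂ)
    (hfdef : f = fun t j => (Real.exp (α * wgt R (φ t) j) : ℂ) * g t j)
    (hg : ∀ j, ∀ t ∈ Set.Icc (0 : ℝ) 1, HasDerivAt (fun s => g s j) (g' t j) t)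
    (hf : ∀ j, ∀ t ∈ Set.Icc (0 : ℝ) 1, HasDerivAt (fun s => f s j) (f' t j) t)
    (hl2 : ∀ t, Summable fun j => ‖g t j‖ ^ 2)
    (hsupp : ∃ a b : ℝ, 0 < a ∧ a ≤ b ∧ b < 1 ∧ ∀ j, ∀ t, t ∉ Set.Icc a b → g t j = 0) :
    -- the decomposition `e^{α|j/R+φe₁|²}(i∂_t + Δ_d)g = Sf + Af`
    (∀ t ∈ Set.Icc (0 : ℝ) 1, ∀ j,
      (Real.exp (α * wgt R (φ t) j) : ℂ) * (Complex.I * g' t j + discreteLap (g t) j) =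
        opS α R φ f f' t j + opA α R φ f t j) ∧
    -- for each fixed `t`, the spatial part of `S` is symmetric on `ℓ²(ℤ^d)`
    (∀ t : ℝ, ∀ h w : (Fin (d + 1) → ℤ) → ℂ,
      (Function.support h).Finite → (Function.support w).Finite →
      (∑' j, opS α R φ (fun _ => h) (fun _ _ => 0) t j * (starRingEnd ℂ) (w j)) =
        ∑' j, h j * (starRingEnd ℂ) (opS α R φ (fun _ => w) (fun _ _ => 0) t j)) ∧
    -- for each fixed `t`, `A` is skew-symmetric on `ℓ²(ℤ^d)`
    (∀ t : ℝ, ∀ h w : (Fin (d + 1) → ℤ) → ℂ,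
      (Function.support h).Finite → (Function.support w).Finite →
      (∑' j, opA α R φ (fun _ => h) t j * (starRingEnd ℂ) (w j)) =
        -∑' j, h j * (starRingEnd ℂ) (opA α R φ (fun _ => w) t j)) := by
  refine ⟨fun t ht j => ?_, fun t h w hh hw => ?_, fun t h w hh hw => ?_⟩
  · have hφt : HasDerivAt φ (deriv φ t) t :=
      ((hφ.differentiable (by simp)) t).hasDerivAt
    have hf' := (hf j t ht).unique (by
      rw [hfdef]
      exact (((hasDerivAt_wgt hφt j).const_mul α).exp.ofReal_comp).mul (hg j t ht))
    rw [mul_add, exp_wgt_mul_discreteLap hR.ne', opS, opA, hf', hfdef]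
    simp only [Finset.sum_add_distrib, Finset.sum_sub_distrib, add_mul, sub_mul,
      Finset.sum_const, Finset.card_univ, Fintype.card_fin, nsmul_eq_mul]
    push_cast
    ring
  · have key := tsum_nearest_neighbour_mul_conj 1 (fun _ => -2 * ((d : ℂ) + 1))
      (fun k j => (Real.cosh (2 * α / R * (((j k : ℝ) + 1 / 2) / R +
        if (k : ℕ) = 0 then φ t else 0)) : ℂ))
      (fun k j => (Real.cosh (2 * α / R * (((j k : ℝ) - 1 / 2) / R +
        if (k : ℕ) = 0 then φ t else 0)) : ℂ))
      (fun j => by simp [Complex.conj_ofNat])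
      (fun k j => by
        rw [Complex.conj_ofReal, one_mul, Pi.add_apply, Pi.single_eq_same]
        push_cast
        ring_nf)
      (fun k j => by
        rw [Complex.conj_ofReal, one_mul, Pi.sub_apply, Pi.single_eq_same]
        push_cast
        ring_nf)
      h w hh hw
    rw [one_mul] at key
    simpa only [opS, mul_zero, zero_sub, neg_mul] using key
  · have key := tsum_nearest_neighbour_mul_conj (-1)
      (fun j => -2 * Complex.I * α * (((j 0 : ℝ) / R + φ t) * deriv φ t))
      (fun k j => -(Real.sinh (2 * α / R * (((j k : ℝ) + 1 / 2) / R +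
        if (k : ℕ) = 0 then φ t else 0)) : ℂ))
      (fun k j => (Real.sinh (2 * α / R * (((j k : ℝ) - 1 / 2) / R +
        if (k : ℕ) = 0 then φ t else 0)) : ℂ))
      (fun j => by simp [Complex.conj_ofNat])
      (fun k j => by
        rw [Complex.conj_ofReal, neg_one_mul, Pi.add_apply, Pi.single_eq_same]
        push_cast
        ring_nf)
      (fun k j => by
        rw [map_neg, Complex.conj_ofReal, neg_one_mul, neg_neg, Pi.sub_apply,
          Pi.single_eq_same]
        push_cast
        ring_nf)
      h w hh hw
    rw [neg_one_mul] at key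
    simpa only [opA, neg_mul, Finset.sum_neg_distrib, ← sub_eq_add_neg] using key
end
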